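/- arXiv:1303.1066 — 5 statements merged into one kernel-verified Lean document; each statement's English description precedes it below -/
import Mathlib

section
/- Let H be a good family of graphs and let m and n be integers with n ≥ m ≥ 2. Then ex(m,H)/m ≤ 2 · ex(n,H)/n. -/
open scoped Classical

noncomputable section

/-- The number of edges of a simple graph. -/
def edgeCount {V : Type} (G : SimpleGraph V) : ℕ := Nat.card G.edgeSet

/-- `G` contains a copy of `H` as a subgraph (an injective homomorphism `H → G`). -/
def ContainsCopy {V W : Type} (G : SimpleGraph V) (H : SimpleGraph W) : Prop :=
  ∃ f : W ↪ V, ∀ a b : W, H.Adj a b → G.Adj (f a) (f b)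

/-- A finite (possibly empty) family of graphs, each given on `Fin n` for some `n`. -/
abbrev GraphFamily := List ((n : ℕ) × SimpleGraph (Fin n))

/-- `G` is `H`-free: it contains no member of the family `H` as a subgraph. -/
def FamilyFree {V : Type} (G : SimpleGraph V) (H : GraphFamily) : Prop :=
  ∀ h ∈ H, ¬ ContainsCopy G h.2

/-- A good family: a finite collection of connected graphs, each containing a cycle. -/
def GoodFamily (H : GraphFamily) : Prop :=
  ∀ h ∈ H, h.2.Connected ∧ ∃ (v : Fin h.1) (w : h.2.Walk v v), w.IsCycle

/-- The Turán number `ex(n, H)`: the maximum number of edges in an `H`-free graph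
on `n` vertices. -/
def turanNumber (n : ℕ) (H : GraphFamily) : ℕ :=
  sSup {e : ℕ | ∃ G : SimpleGraph (Fin n), FamilyFree G H ∧ e = edgeCount G}

/-- `n_H(k)`: the smallest `n` with `n * k ≤ 2 * ex(n, H)`, i.e. the minimum number of
vertices in an `H`-free graph of average degree at least `k`. -/
def minFreeOrder (H : GraphFamily) (k : ℝ) : ℕ :=
  sInf {n : ℕ | (n : ℝ) * k ≤ 2 * (turanNumber n H : ℝ)}

/-- The probability that the `p`-random subgraph `G_p` of `G` satisfies the predicate `P`:
each edge of `G` is retained independently with probability `p`, so the spanning subgraph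
with edge set `E'` has probability `p ^ |E'| * (1 - p) ^ (e(G) - |E'|)`. -/
def randProb {V : Type} [Fintype V] (G : SimpleGraph V) (p : ℝ)
    (P : SimpleGraph V → Prop) : ℝ :=
  ∑ E' ∈ G.edgeFinset.powerset,
    (if P (SimpleGraph.fromEdgeSet (E' : Set (Sym2 V)))
     then p ^ E'.card * (1 - p) ^ (G.edgeFinset.card - E'.card) else 0)

/-- The expectation of `f` over the `p`-random subgraph `G_p` of `G`. -/
def randExpect {V : Type} [Fintype V] (G : SimpleGraph V) (p : ℝ)
    (f : SimpleGraph V → ℝ) : ℝ :=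
  ∑ E' ∈ G.edgeFinset.powerset,
    f (SimpleGraph.fromEdgeSet (E' : Set (Sym2 V))) *
      (p ^ E'.card * (1 - p) ^ (G.edgeFinset.card - E'.card))

/-- The number of excess edges of a graph `F`:
`exc(F) = e(F) - |V(F)| + (number of connected components of F)`. -/
def excess {V : Type} [Fintype V] (F : SimpleGraph V) : ℤ :=
  (edgeCount F : ℤ) - (Fintype.card V : ℤ) + (Nat.card F.ConnectedComponent : ℤ)

/-- `G` has minimum degree at least `k`. -/
def MinDegreeAtLeast {V : Type} (G : SimpleGraph V) (k : ℕ) : Prop :=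
  ∀ v : V, k ≤ Nat.card (G.neighborSet v)

end

/-- Consecutive copies of `G` placed on the blocks of length `m` of `Fin n`, the last one
truncated. -/
def blockCopies {m : ℕ} (hm : 0 < m) (n : ℕ) (G : SimpleGraph (Fin m)) :
    SimpleGraph (Fin n) where
  Adj v w := v.1 / m = w.1 / m ∧ G.Adj ⟨v.1 % m, Nat.mod_lt _ hm⟩ ⟨w.1 % m, Nat.mod_lt _ hm⟩
  symm := ⟨fun _ _ h => ⟨h.1.symm, h.2.symm⟩⟩
  loopless := ⟨fun _ h => G.irrefl h.2⟩

theorem containsCopy_of_blockCopies {W : Type} {m n : ℕ} (hm : 0 < m)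
    {G : SimpleGraph (Fin m)} {F : SimpleGraph W} (hF : F.Connected)
    (h : ContainsCopy (blockCopies hm n G) F) : ContainsCopy G F := by
  obtain ⟨f, hf⟩ := h
  have hblock : ∀ a b : W, (f a).1 / m = (f b).1 / m := by
    intro a b
    obtain ⟨p⟩ := hF.preconnected a b
    induction p with
    | nil => rfl
    | cons hadj _ ih => exact (hf _ _ hadj).1.trans ih
  refine ⟨⟨fun a => ⟨(f a).1 % m, Nat.mod_lt _ hm⟩, fun a b hab => f.injective ?_⟩,
    fun a b hab => (hf a b hab).2⟩
  have hmod : (f a).1 % m = (f b).1 % m := congrArg Fin.val hab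
  rw [Fin.ext_iff, ← Nat.div_add_mod (f a).1 m, ← Nat.div_add_mod (f b).1 m, hblock a b, hmod]

theorem mul_edgeCount_le_edgeCount_blockCopies {m n q : ℕ} (hm : 0 < m) (hq : q * m ≤ n)
    (G : SimpleGraph (Fin m)) : q * edgeCount G ≤ edgeCount (blockCopies hm n G) := by
  let φ : Fin q × Fin m → Fin n := fun x => Fin.castLE hq (finProdFinEquiv x)
  have hφ : Function.Injective φ :=
    (Fin.castLE_injective hq).comp finProdFinEquiv.injective
  have hval : ∀ x, (φ x).1 = x.2.1 + m * x.1.1 := fun x => rfl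
  have hadj : ∀ k a b, G.Adj a b → (blockCopies hm n G).Adj (φ (k, a)) (φ (k, b)) := by
    intro k a b hab
    simp only [blockCopies, hval, Nat.add_mul_div_left _ _ hm, Nat.add_mul_mod_self_left,
      Nat.mod_eq_of_lt a.2, Nat.mod_eq_of_lt b.2, Nat.div_eq_of_lt a.2, Nat.div_eq_of_lt b.2]
    exact ⟨trivial, hab⟩
  have hmem : ∀ x : Fin q × G.edgeSet,
      Sym2.map (fun a => φ (x.1, a)) x.2.1 ∈ (blockCopies hm n G).edgeSet := by
    rintro ⟨k, ⟨e, he⟩⟩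
    induction e with
    | h a b => exact hadj k a b he
  let ψ : Fin q × G.edgeSet → (blockCopies hm n G).edgeSet := fun x => ⟨_, hmem x⟩
  have hψ : Function.Injective ψ := by
    rintro ⟨k, ⟨e, he⟩⟩ ⟨l, ⟨e', he'⟩⟩ heq
    have heq' : Sym2.map (fun a => φ (k, a)) e = Sym2.map (fun a => φ (l, a)) e' :=
      congrArg Subtype.val heq
    induction e with
    | h a b =>
      induction e' with
      | h c d =>
        simp only [Sym2.map_mk, Sym2.eq_iff, hφ.eq_iff, Prod.mk.injEq] at heq'
        simp only [Prod.mk.injEq, Subtype.mk.injEq, Sym2.eq_iff]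
        tauto
  simpa [edgeCount, Nat.card_prod] using Nat.card_le_card_of_injective ψ hψ

theorem bddAbove_edgeCount (n : ℕ) (H : GraphFamily) :
    BddAbove {e : ℕ | ∃ G : SimpleGraph (Fin n), FamilyFree G H ∧ e = edgeCount G} := by
  refine ((Set.finite_range fun G : SimpleGraph (Fin n) => edgeCount G).subset ?_).bddAbove
  rintro _ ⟨G, -, rfl⟩
  exact ⟨G, rfl⟩

theorem mul_turanNumber_le_turanNumber {H : GraphFamily} (hH : ∀ h ∈ H, h.2.Connected)
    {m n q : ℕ} (hm : 0 < m) (hq : q * m ≤ n) :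
    q * turanNumber m H ≤ turanNumber n H := by
  rcases Set.eq_empty_or_nonempty
    {e : ℕ | ∃ G : SimpleGraph (Fin m), FamilyFree G H ∧ e = edgeCount G} with h0 | hne
  · simp [turanNumber, h0]
  · obtain ⟨G, hG, hGe⟩ := Nat.sSup_mem hne (bddAbove_edgeCount m H)
    have hex : turanNumber m H = edgeCount G := hGe
    rw [hex]
    refine (mul_edgeCount_le_edgeCount_blockCopies hm hq G).trans
      (le_csSup (bddAbove_edgeCount n H) ⟨_, fun h hh hc => ?_, rfl⟩)
    exact hG h hh (containsCopy_of_blockCopies hm (hH h hh) hc)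

/-- **Lemma 6.** For a good family `H` and integers `n ≥ m ≥ 2`,
`ex(m,H)/m ≤ 2 · ex(n,H)/n`. -/
theorem turanNumber_div_le_two_mul_div (H : GraphFamily) (hH : GoodFamily H)
    (m n : ℕ) (hm : 2 ≤ m) (hmn : m ≤ n) :
    (turanNumber m H : ℝ) / (m : ℝ) ≤ 2 * ((turanNumber n H : ℝ) / (n : ℝ)) := by
  have hm0 : 0 < m := by omega
  have hcopies := mul_turanNumber_le_turanNumber (fun h hh => (hH h hh).1) hm0
    (Nat.div_mul_le_self n m)
  have hn : n ≤ 2 * (n / m * m) := by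
    have hlt := Nat.mod_lt n hm0
    have hdiv := Nat.div_add_mod' n m
    have hle := Nat.le_mul_of_pos_left m (Nat.div_pos hmn hm0)
    omega
  have key : turanNumber m H * n ≤ 2 * turanNumber n H * m :=
    calc turanNumber m H * n ≤ turanNumber m H * (2 * (n / m * m)) := Nat.mul_le_mul_left _ hn
      _ = 2 * (n / m * turanNumber m H) * m := by ring
      _ ≤ 2 * turanNumber n H * m := by gcongr
  rw [← mul_div_assoc, div_le_div_iff₀ (by exact_mod_cast hm0)
    (by exact_mod_cast hm0.trans_le hmn)]
  exact_mod_cast key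
end

section
/- Let G be an arbitrary finite graph, let p ∈ [0,1/2], and let μ denote the expected value of exc(G_p), the number of excess edges of the p-random subgraph G_p. Then for every β ∈ (0,1], the probability that |exc(G_p) − μ| ≥ β·p·e(G) is at most 2·exp(−β²·p·e(G)/3), where e(G) is the number of edges of G. -/
open scoped Classical

namespace SimpleGraph

/-- A pair reachable after adding the edge `uv` is either reachable before, or connected through
`u` and `v`. -/
theorem Reachable.of_sup_edge {V : Type} {F : SimpleGraph V} {u v x y : V}
    (h : (F ⊔ edge u v).Reachable x y) :
    F.Reachable x y ∨ (F.Reachable x u ∧ F.Reachable v y) ∨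
      (F.Reachable x v ∧ F.Reachable u y) := by
  obtain ⟨w⟩ := h
  induction w with
  | nil => exact .inl .rfl
  | cons hadj _ ih =>
    rw [sup_adj, edge_adj] at hadj
    rcases hadj with hadj | ⟨⟨rfl, rfl⟩ | ⟨rfl, rfl⟩, -⟩
    · rcases ih with h | ⟨h, h'⟩ | ⟨h, h'⟩
      · exact .inl (hadj.reachable.trans h)
      · exact .inr (.inl ⟨hadj.reachable.trans h, h'⟩)
      · exact .inr (.inr ⟨hadj.reachable.trans h, h'⟩)
    · rcases ih with h | ⟨-, h⟩ | ⟨-, h⟩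
      · exact .inr (.inl ⟨.rfl, h⟩)
      · exact .inr (.inl ⟨.rfl, h⟩)
      · exact .inl h
    · rcases ih with h | ⟨-, h⟩ | ⟨-, h⟩
      · exact .inr (.inr ⟨.rfl, h⟩)
      · exact .inl h
      · exact .inr (.inr ⟨.rfl, h⟩)

/-- Adding an edge decreases the number of connected components by at most one. -/
theorem card_connectedComponent_le_card_sup_edge_add_one {V : Type} [Finite V]
    (F : SimpleGraph V) (u v : V) :
    Nat.card F.ConnectedComponent ≤ Nat.card (F ⊔ edge u v).ConnectedComponent + 1 := by
  let φ : F.ConnectedComponent → (F ⊔ edge u v).ConnectedComponent :=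
    ConnectedComponent.map (Hom.ofLE le_sup_left)
  let ψ : F.ConnectedComponent → Option (F ⊔ edge u v).ConnectedComponent :=
    fun c => if c = F.connectedComponentMk v then none else some (φ c)
  have hψ : Function.Injective ψ := by
    intro c d hcd
    by_cases hc : c = F.connectedComponentMk v <;> by_cases hd : d = F.connectedComponentMk v
    · rw [hc, hd]
    · simp [ψ, hc, hd] at hcd
    · simp [ψ, hc, hd] at hcd
    · simp only [ψ, hc, hd, if_false, Option.some.injEq] at hcd
      induction c using ConnectedComponent.ind with | _ x
      induction d using ConnectedComponent.ind with | _ y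
      rw [ConnectedComponent.eq] at hc hd ⊢
      rcases (ConnectedComponent.exact hcd).of_sup_edge with h | ⟨-, h⟩ | ⟨h, -⟩
      · exact h
      · exact absurd h.symm hd
      · exact absurd h hc
  simpa [Finite.card_option] using Nat.card_le_card_of_injective ψ hψ

end SimpleGraph

/-- Adding an edge changes the excess by `0` or `1`. -/
theorem excess_sup_edge {V : Type} [Fintype V] (F : SimpleGraph V) (u v : V) :
    excess F ≤ excess (F ⊔ SimpleGraph.edge u v) ∧
      excess (F ⊔ SimpleGraph.edge u v) ≤ excess F + 1 := by
  by_cases h : F ⊔ SimpleGraph.edge u v = F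
  · simp [h]
  have hne : u ≠ v := by
    rintro rfl
    exact h (by simp)
  have hadj : ¬ F.Adj u v := fun hadj => h (SimpleGraph.sup_edge_of_adj F hadj)
  have hedge : edgeCount (F ⊔ SimpleGraph.edge u v) = edgeCount F + 1 := by
    rw [edgeCount, edgeCount, Nat.card_eq_fintype_card, Nat.card_eq_fintype_card,
      ← SimpleGraph.edgeFinset_card, ← SimpleGraph.edgeFinset_card]
    exact F.card_edgeFinset_sup_edge hadj hne
  have h1 := F.card_connectedComponent_le_card_sup_edge_add_one u v
  have h2 := SimpleGraph.ConnectedComponent.card_le_card_of_le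
    (le_sup_left : F ≤ F ⊔ SimpleGraph.edge u v)
  unfold excess
  omega

theorem excess_fromEdgeSet_insert {V : Type} [Fintype V] (S : Set (Sym2 V)) (e : Sym2 V) :
    excess (SimpleGraph.fromEdgeSet S) ≤ excess (SimpleGraph.fromEdgeSet (insert e S)) ∧
      excess (SimpleGraph.fromEdgeSet (insert e S)) ≤ excess (SimpleGraph.fromEdgeSet S) + 1 := by
  induction e with | _ u v
  rw [← Set.union_singleton, SimpleGraph.fromEdgeSet_union]
  exact excess_sup_edge _ u v

theorem Real.exp_le_one_add_add_three_quarters_sq {x : ℝ} (hx : |x| ≤ 2 / 3) :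
    Real.exp x ≤ 1 + x + 3 / 4 * x ^ 2 := by
  have h := (abs_le.1 (Real.exp_bound (hx.trans (by norm_num)) (n := 3) (by norm_num))).2
  norm_num [Finset.sum_range_succ, Nat.factorial] at h
  have h3 : |x| ^ 3 ≤ 2 / 3 * x ^ 2 := by
    rw [pow_succ, sq_abs, mul_comm]
    exact mul_le_mul_of_nonneg_right hx (sq_nonneg x)
  nlinarith [sq_nonneg x]

/-- The expectation of `f` over a random subset of `U` containing each element independently
with probability `p`. -/
noncomputable def randomSubsetExpect {α : Type} (p : ℝ) (U : Finset α) (f : Finset α → ℝ) : ℝ :=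
  ∑ S ∈ U.powerset, f S * (p ^ S.card * (1 - p) ^ (U.card - S.card))

theorem randomSubsetExpect_insert {α : Type} (p : ℝ) {U : Finset α} {a : α} (ha : a ∉ U)
    (f : Finset α → ℝ) :
    randomSubsetExpect p (insert a U) f =
      (1 - p) * randomSubsetExpect p U f +
        p * randomSubsetExpect p U (fun S => f (insert a S)) := by
  unfold randomSubsetExpect
  rw [Finset.sum_powerset_insert ha, Finset.mul_sum, Finset.mul_sum]
  congr 1 <;> refine Finset.sum_congr rfl fun S hS => ?_
  · have hcard := Finset.card_le_card (Finset.mem_powerset.1 hS)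
    rw [Finset.card_insert_of_notMem ha, Nat.sub_add_comm hcard]
    ring
  · have haS : a ∉ S := fun h => ha (Finset.mem_powerset.1 hS h)
    rw [Finset.card_insert_of_notMem ha, Finset.card_insert_of_notMem haS,
      Nat.add_sub_add_right]
    ring

theorem randomSubsetExpect_mono {α : Type} {p : ℝ} (hp0 : 0 ≤ p) (hp1 : p ≤ 1) (U : Finset α)
    {f g : Finset α → ℝ} (h : ∀ S, f S ≤ g S) :
    randomSubsetExpect p U f ≤ randomSubsetExpect p U g := by
  have := sub_nonneg.2 hp1
  exact Finset.sum_le_sum fun S _ => mul_le_mul_of_nonneg_right (h S) (by positivity)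

theorem randomSubsetExpect_add_const {α : Type} (p : ℝ) (U : Finset α) (f : Finset α → ℝ)
    (c : ℝ) :
    randomSubsetExpect p U (fun S => f S + c) = randomSubsetExpect p U f + c := by
  have h := Finset.sum_pow_mul_eq_add_pow p (1 - p) U
  rw [add_sub_cancel, one_pow] at h
  simp only [randomSubsetExpect, add_mul, Finset.sum_add_distrib, ← Finset.mul_sum, h, mul_one]

/-- Exponential moment bound for functions of a random subset whose increments lie in `[0, 1]`. -/
theorem randomSubsetExpect_exp_le {α : Type} {p l : ℝ} (hp0 : 0 ≤ p) (hp1 : p ≤ 1)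
    (hl : |l| ≤ 2 / 3) (U : Finset α) (f : Finset α → ℝ)
    (hf : ∀ S a, f S ≤ f (insert a S) ∧ f (insert a S) ≤ f S + 1) :
    randomSubsetExpect p U (fun S => Real.exp (l * f S)) ≤
      Real.exp (l * randomSubsetExpect p U f + U.card * (3 / 4 * l ^ 2 * p)) := by
  induction U using Finset.induction_on generalizing f with
  | empty => simp [randomSubsetExpect]
  | insert a U ha ih =>
    have ih0 := ih f hf
    have ih1 := ih (fun S => f (insert a S)) fun S b => by
      rw [Finset.insert_comm]
      exact hf (insert a S) b
    have hd0 := randomSubsetExpect_mono hp0 hp1 U fun S => (hf S a).1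
    have hd1 := randomSubsetExpect_mono hp0 hp1 U fun S => (hf S a).2
    rw [randomSubsetExpect_add_const] at hd1
    rw [randomSubsetExpect_insert p ha, randomSubsetExpect_insert p ha,
      Finset.card_insert_of_notMem ha]
    set m₀ := randomSubsetExpect p U f
    set m₁ := randomSubsetExpect p U (fun S => f (insert a S))
    obtain ⟨d, hd⟩ : ∃ d, d = m₁ - m₀ := ⟨_, rfl⟩
    have hd_nonneg : 0 ≤ d := by linarith
    have hd_le : d ≤ 1 := by linarith
    have hld : |l * d| ≤ 2 / 3 := by
      rw [abs_mul, abs_of_nonneg hd_nonneg]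
      nlinarith [abs_nonneg l]
    have hexp := Real.exp_le_one_add_add_three_quarters_sq hld
    have hsq : (l * d) ^ 2 ≤ l ^ 2 := by
      rw [mul_pow]
      exact mul_le_of_le_one_right (sq_nonneg l) (pow_le_one₀ hd_nonneg hd_le)
    have hstep : 1 - p + p * Real.exp (l * d) ≤ Real.exp (p * (l * d) + 3 / 4 * l ^ 2 * p) := by
      refine le_trans ?_ (Real.add_one_le_exp _)
      nlinarith [mul_le_mul_of_nonneg_left hexp hp0, mul_le_mul_of_nonneg_left hsq hp0]
    set c := (U.card : ℝ) * (3 / 4 * l ^ 2 * p) with hc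
    have hm₁ : Real.exp (l * m₁ + c) = Real.exp (l * m₀ + c) * Real.exp (l * d) := by
      rw [← Real.exp_add, hd]
      ring_nf
    calc _ ≤ (1 - p) * Real.exp (l * m₀ + c) + p * Real.exp (l * m₁ + c) :=
          add_le_add (mul_le_mul_of_nonneg_left ih0 (sub_nonneg.2 hp1))
            (mul_le_mul_of_nonneg_left ih1 hp0)
      _ = Real.exp (l * m₀ + c) * (1 - p + p * Real.exp (l * d)) := by rw [hm₁]; ring
      _ ≤ Real.exp (l * m₀ + c) * Real.exp (p * (l * d) + 3 / 4 * l ^ 2 * p) :=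
          mul_le_mul_of_nonneg_left hstep (Real.exp_pos _).le
      _ = _ := by
          rw [← Real.exp_add, hd, hc]
          push_cast
          ring_nf

theorem indicator_le_exp_add_exp {t x a : ℝ} (ht : 0 ≤ t) :
    (if a ≤ |x| then (1 : ℝ) else 0) ≤ Real.exp (t * x - t * a) + Real.exp (-t * x - t * a) := by
  split_ifs with h
  · rcases le_abs'.1 h with h | h
    · have := Real.one_le_exp (show 0 ≤ -t * x - t * a by nlinarith)
      linarith [Real.exp_pos (t * x - t * a)]
    · have := Real.one_le_exp (show 0 ≤ t * x - t * a by nlinarith)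
      linarith [Real.exp_pos (-t * x - t * a)]
  · positivity

theorem randomSubsetExpect_indicator_le {α : Type} {p β : ℝ} (hp0 : 0 ≤ p) (hp1 : p ≤ 1)
    (hβ0 : 0 ≤ β) (hβ1 : β ≤ 1) (U : Finset α) (f : Finset α → ℝ)
    (hf : ∀ S a, f S ≤ f (insert a S) ∧ f (insert a S) ≤ f S + 1) :
    randomSubsetExpect p U
        (fun S => if β * p * U.card ≤ |f S - randomSubsetExpect p U f| then 1 else 0) ≤
      2 * Real.exp (-(β ^ 2 * p * U.card / 3)) := by
  set m := randomSubsetExpect p U f with hm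
  set t := 2 * β / 3 with ht
  have ht0 : 0 ≤ t := by positivity
  have hside (l : ℝ) (hl : |l| = t) :
      randomSubsetExpect p U (fun S => Real.exp (l * (f S - m) - t * (β * p * U.card))) ≤
        Real.exp (-(β ^ 2 * p * U.card / 3)) := by
    have h := randomSubsetExpect_exp_le hp0 hp1 (hl.trans_le (by linarith)) U f hf
    have hl2 : l ^ 2 = t ^ 2 := by rw [← sq_abs, hl]
    have hfactor : randomSubsetExpect p U
          (fun S => Real.exp (l * (f S - m) - t * (β * p * U.card))) =
        Real.exp (-(l * m) - t * (β * p * U.card)) *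
          randomSubsetExpect p U (fun S => Real.exp (l * f S)) := by
      unfold randomSubsetExpect
      rw [Finset.mul_sum]
      refine Finset.sum_congr rfl fun S _ => ?_
      beta_reduce
      rw [← mul_assoc (Real.exp _) (Real.exp _), ← Real.exp_add]
      ring_nf
    rw [hfactor]
    refine (mul_le_mul_of_nonneg_left h (Real.exp_pos _).le).trans_eq ?_
    rw [← Real.exp_add, ← hm, hl2, ht]
    ring_nf
  calc _ ≤ randomSubsetExpect p U (fun S => Real.exp (t * (f S - m) - t * (β * p * U.card)) +
          Real.exp (-t * (f S - m) - t * (β * p * U.card))) :=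
        randomSubsetExpect_mono hp0 hp1 U fun S => indicator_le_exp_add_exp ht0
    _ = randomSubsetExpect p U (fun S => Real.exp (t * (f S - m) - t * (β * p * U.card))) +
        randomSubsetExpect p U (fun S => Real.exp (-t * (f S - m) - t * (β * p * U.card))) := by
        simp only [randomSubsetExpect, add_mul, Finset.sum_add_distrib]
    _ ≤ _ := by
        linarith [hside t (abs_of_nonneg ht0), hside (-t) (by rw [abs_neg, abs_of_nonneg ht0])]

/-- **Proposition 9.** Let `G` be an arbitrary finite graph, `p ∈ [0,1/2]`, and let `μ` be the
expected number of excess edges of `G_p`. Then for every `β ∈ (0,1]`, the probability that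
`|exc(G_p) - μ| ≥ β·p·e(G)` is at most `2·exp(-β²·p·e(G)/3)`. -/
theorem excess_concentration {V : Type} [Fintype V] (G : SimpleGraph V)
    (p : ℝ) (hp0 : 0 ≤ p) (hp : p ≤ 1 / 2)
    (μ : ℝ) (hμ : μ = randExpect G p (fun F => (excess F : ℝ)))
    (β : ℝ) (hβ0 : 0 < β) (hβ1 : β ≤ 1) :
    randProb G p (fun F => β * p * (edgeCount G : ℝ) ≤ |(excess F : ℝ) - μ|) ≤
      2 * Real.exp (-(β ^ 2 * p * (edgeCount G : ℝ) / 3)) := by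
  have hcard : edgeCount G = G.edgeFinset.card := by
    rw [edgeCount, Nat.card_eq_fintype_card, SimpleGraph.edgeFinset_card]
  have h := randomSubsetExpect_indicator_le hp0 (hp.trans (by norm_num)) hβ0.le hβ1 G.edgeFinset
    (fun S => (excess (SimpleGraph.fromEdgeSet (S : Set (Sym2 V))) : ℝ)) fun S e => by
      have := excess_fromEdgeSet_insert (S : Set (Sym2 V)) e
      simp only [Finset.coe_insert]
      exact_mod_cast this
  have hmean : randomSubsetExpect p G.edgeFinset
      (fun S => (excess (SimpleGraph.fromEdgeSet (S : Set (Sym2 V))) : ℝ)) = μ := hμ.symm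
  rw [hmean] at h
  rw [hcard]
  refine le_trans (le_of_eq ?_) h
  exact Finset.sum_congr rfl fun S _ => by rw [ite_mul, one_mul, zero_mul]
end

section
/- Let ε ∈ (0,1/3), let k be a positive integer, let G be a finite graph with minimum degree at least k, and let v be an arbitrary vertex of G. If p ∈ [0,1] satisfies p ≥ (1+ε)/k, then the probability that the connected component of v in the p-random subgraph G_p has at least εk/2 vertices is strictly greater than ε/6. -/
open scoped Classical

section RandomEdgeSubset

variable {α : Type}

/-- The probability that a random subset of `E`, containing each element independently with
probability `p`, satisfies `Q`. -/
noncomputable def subsetProb (p : ℝ) (E : Finset α) (Q : Finset α → Prop) : ℝ :=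
  ∑ E' ∈ E.powerset, if Q E' then p ^ E'.card * (1 - p) ^ (E.card - E'.card) else 0

theorem subsetProb_mono {p : ℝ} (hp0 : 0 ≤ p) (hp1 : p ≤ 1) (E : Finset α)
    {Q R : Finset α → Prop} (h : ∀ E' ⊆ E, Q E' → R E') :
    subsetProb p E Q ≤ subsetProb p E R := by
  refine Finset.sum_le_sum fun E' hE' => ?_
  have hw : 0 ≤ p ^ E'.card * (1 - p) ^ (E.card - E'.card) :=
    mul_nonneg (pow_nonneg hp0 _) (pow_nonneg (sub_nonneg.2 hp1) _)
  by_cases hQ : Q E'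
  · rw [if_pos hQ, if_pos (h E' (Finset.mem_powerset.1 hE') hQ)]
  · rw [if_neg hQ]
    split_ifs
    exacts [hw, le_rfl]

theorem subsetProb_add_not (p : ℝ) (E : Finset α) (Q : Finset α → Prop) :
    subsetProb p E Q + subsetProb p E (fun E' => ¬ Q E') = 1 := by
  rw [subsetProb, subsetProb, ← Finset.sum_add_distrib]
  calc _ = ∑ E' ∈ E.powerset, p ^ E'.card * (1 - p) ^ (E.card - E'.card) := by
        refine Finset.sum_congr rfl fun E' _ => ?_
        by_cases hQ : Q E' <;> simp [hQ]
    _ = 1 := by rw [Finset.sum_pow_mul_eq_add_pow]; simp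

theorem subsetProb_nonneg {p : ℝ} (hp0 : 0 ≤ p) (hp1 : p ≤ 1) (E : Finset α)
    (Q : Finset α → Prop) : 0 ≤ subsetProb p E Q := by
  refine Finset.sum_nonneg fun E' _ => ?_
  split_ifs
  exacts [mul_nonneg (pow_nonneg hp0 _) (pow_nonneg (sub_nonneg.2 hp1) _), le_rfl]

theorem subsetProb_le_one {p : ℝ} (hp0 : 0 ≤ p) (hp1 : p ≤ 1) (E : Finset α)
    (Q : Finset α → Prop) : subsetProb p E Q ≤ 1 := by
  linarith [subsetProb_add_not p E Q, subsetProb_nonneg hp0 hp1 E fun E' => ¬ Q E']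

/-- Conditioning on whether the element `e` is chosen. -/
theorem subsetProb_eq_erase [DecidableEq α] (p : ℝ) {E : Finset α} {e : α} (he : e ∈ E)
    (Q : Finset α → Prop) :
    subsetProb p E Q = (1 - p) * subsetProb p (E.erase e) Q +
      p * subsetProb p (E.erase e) (fun E' => Q (insert e E')) := by
  obtain ⟨F, heF, rfl⟩ : ∃ F, e ∉ F ∧ insert e F = E :=
    ⟨E.erase e, Finset.notMem_erase _ _, Finset.insert_erase he⟩
  rw [Finset.erase_insert heF, subsetProb, Finset.sum_powerset_insert heF, subsetProb,
    subsetProb, Finset.mul_sum, Finset.mul_sum]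
  congr 1 <;> refine Finset.sum_congr rfl fun E' hE' => ?_
  · have hc := Finset.card_le_card (Finset.mem_powerset.1 hE')
    rw [Finset.card_insert_of_notMem heF, Nat.succ_sub hc, pow_succ]
    split_ifs <;> ring
  · have heE' : e ∉ E' := fun h => heF (Finset.mem_powerset.1 hE' h)
    rw [Finset.card_insert_of_notMem heF, Finset.card_insert_of_notMem heE',
      Nat.add_sub_add_right, pow_succ]
    split_ifs <;> ring

end RandomEdgeSubset

section Exploration

variable {V : Type} [Fintype V]

/-- The number of vertices joined to `S` by a path with edges in `E`. -/
noncomputable def reachCard (S : Finset V) (E : Finset (Sym2 V)) : ℕ :=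
  Nat.card {w : V | ∃ s ∈ S, (SimpleGraph.fromEdgeSet (E : Set (Sym2 V))).Reachable s w}

theorem card_le_reachCard (S : Finset V) (E : Finset (Sym2 V)) : S.card ≤ reachCard S E := by
  have hsub : (S : Set V) ⊆
      {w : V | ∃ s ∈ S, (SimpleGraph.fromEdgeSet (E : Set (Sym2 V))).Reachable s w} :=
    fun s hs => ⟨s, hs, SimpleGraph.Reachable.refl s⟩
  simpa [reachCard] using Nat.card_mono (Set.toFinite _) hsub

theorem reachCard_insert_le {S : Finset V} {E : Finset (Sym2 V)} {a y : V}
    (ha : a ∈ S) (hy : y ∉ S) :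
    reachCard (insert y S) E ≤ reachCard S (insert s(a, y) E) := by
  have hle : SimpleGraph.fromEdgeSet (E : Set (Sym2 V)) ≤
      SimpleGraph.fromEdgeSet ((insert s(a, y) E : Finset (Sym2 V)) : Set (Sym2 V)) :=
    SimpleGraph.fromEdgeSet_mono (by simp)
  refine Nat.card_mono (Set.toFinite _) ?_
  rintro w ⟨s, hs, hw⟩
  rcases Finset.mem_insert.1 hs with rfl | hs
  · have hadj : (SimpleGraph.fromEdgeSet
        ((insert s(a, s) E : Finset (Sym2 V)) : Set (Sym2 V))).Adj a s := by
      rw [SimpleGraph.fromEdgeSet_adj]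
      exact ⟨by simp, fun h => hy (h ▸ ha)⟩
    exact ⟨a, ha, hadj.reachable.trans (hw.mono hle)⟩
  · exact ⟨s, hs, hw.mono hle⟩

/-- Edge-by-edge exploration of the set of vertices reachable from `S`: the edges in `E` are
unexposed, those from the active vertices `A ⊆ S` to the outside of `S` are all among them, and
`a` is a partially processed vertex whose edges to `T` are still unexposed. -/
theorem subsetProb_reachCard_lt_le (G : SimpleGraph V) {p q M : ℝ} (hp0 : 0 ≤ p) (hp1 : p ≤ 1)
    (hq0 : 0 ≤ q)
    (hext : ∀ (S : Finset V), ∀ x ∈ S, (S.card : ℝ) < M →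
      (1 - p + p * q) ^ (Finset.univ.filter fun z => G.Adj x z ∧ z ∉ S).card ≤ q)
    (n : ℕ) : ∀ (S A T : Finset V) (E : Finset (Sym2 V)) (a : V),
      2 * E.card + A.card ≤ n → A ⊆ S → (∀ y ∈ T, a ∈ S ∧ a ∉ A ∧ y ∉ S ∧ s(a, y) ∈ E) →
      (∀ b z, (b ∈ A ∨ b ∉ S) → z ∉ S → G.Adj b z → s(b, z) ∈ E) →
      subsetProb p E (fun E' => (reachCard S E' : ℝ) < M) ≤
        q ^ A.card * (1 - p + p * q) ^ T.card := by
  have hr0 : 0 ≤ 1 - p + p * q := add_nonneg (sub_nonneg.2 hp1) (mul_nonneg hp0 hq0)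
  induction n with
  | zero =>
    intro S A T E a hn _ hT _
    have hE : E = ∅ := Finset.card_eq_zero.1 (by omega)
    have hA : A = ∅ := Finset.card_eq_zero.1 (by omega)
    have hT' : T = ∅ := Finset.eq_empty_of_forall_notMem fun y hy => by
      simpa [hE] using (hT y hy).2.2.2
    simpa [hA, hT'] using subsetProb_le_one hp0 hp1 E _
  | succ n ih =>
    intro S A T E a hn hAS hT hinv
    rcases T.eq_empty_or_nonempty with rfl | ⟨y, hy⟩
    · rcases A.eq_empty_or_nonempty with rfl | ⟨x, hx⟩
      · simpa using subsetProb_le_one hp0 hp1 E _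
      · by_cases hM : (S.card : ℝ) < M
        · have hcard := Finset.card_erase_add_one hx
          have h := ih S (A.erase x) (Finset.univ.filter fun z => G.Adj x z ∧ z ∉ S) E x
            (by omega) ((Finset.erase_subset _ _).trans hAS)
            (fun z hz => by
              obtain ⟨h1, h2⟩ := (Finset.mem_filter.1 hz).2
              exact ⟨hAS hx, Finset.notMem_erase _ _, h2, hinv x z (Or.inl hx) h2 h1⟩)
            (fun b z hb => hinv b z (hb.imp_left fun h => Finset.mem_of_mem_erase h))
          refine h.trans ?_
          rw [← hcard, Finset.card_empty, pow_zero, mul_one, pow_succ]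
          exact mul_le_mul_of_nonneg_left (hext S x (hAS hx) hM) (pow_nonneg hq0 _)
        · have h0 : subsetProb p E (fun E' => (reachCard S E' : ℝ) < M) = 0 := by
            refine Finset.sum_eq_zero fun E' _ => if_neg ?_
            have : (S.card : ℝ) ≤ reachCard S E' := by exact_mod_cast card_le_reachCard S E'
            linarith
          rw [h0]
          exact mul_nonneg (pow_nonneg hq0 _) (pow_nonneg hr0 _)
    · obtain ⟨haS, haA, hyS, he⟩ := hT y hy
      have hyA : y ∉ A := fun h => hyS (hAS h)
      have hEcard := Finset.card_erase_add_one he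
      have hTcard := Finset.card_erase_add_one hy
      have hne : ∀ z ∈ T.erase y, s(a, z) ∈ E.erase s(a, y) := fun z hz => by
        refine Finset.mem_erase.2 ⟨fun h => Finset.ne_of_mem_erase hz ?_,
          (hT z (Finset.mem_of_mem_erase hz)).2.2.2⟩
        exact Sym2.congr_right.1 h
      have habsent := ih S A (T.erase y) (E.erase s(a, y)) a (by omega) hAS
        (fun z hz => ⟨haS, haA, (hT z (Finset.mem_of_mem_erase hz)).2.2.1, hne z hz⟩)
        (fun b z hb hz hbz => by
          refine Finset.mem_erase.2 ⟨fun h => ?_, hinv b z hb hz hbz⟩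
          rcases Sym2.eq_iff.1 h with ⟨rfl, rfl⟩ | ⟨rfl, rfl⟩
          · tauto
          · exact hz haS)
      have hpresent := ih (insert y S) (insert y A) (T.erase y) (E.erase s(a, y)) a
        (by rw [Finset.card_insert_of_notMem hyA]; omega)
        (Finset.insert_subset_insert _ hAS)
        (fun z hz => by
          refine ⟨Finset.mem_insert_of_mem haS,
            fun h => (Finset.mem_insert.1 h).elim (fun h => hyS (h ▸ haS)) haA,
            fun h => ?_, hne z hz⟩
          exact (Finset.mem_insert.1 h).elim (Finset.ne_of_mem_erase hz)
            (hT z (Finset.mem_of_mem_erase hz)).2.2.1)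
        (fun b z hb hz hbz => by
          rw [Finset.mem_insert, not_or] at hz
          refine Finset.mem_erase.2 ⟨fun h => ?_, hinv b z ?_ hz.2 hbz⟩
          · rcases Sym2.eq_iff.1 h with ⟨_, rfl⟩ | ⟨_, rfl⟩
            · exact hz.1 rfl
            · exact hz.2 haS
          · rcases hb with hb | hb
            · rcases Finset.mem_insert.1 hb with rfl | hb
              exacts [Or.inr hyS, Or.inl hb]
            · exact Or.inr fun h => hb (Finset.mem_insert_of_mem h))
      rw [Finset.card_insert_of_notMem hyA] at hpresent
      have hmono : subsetProb p (E.erase s(a, y))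
            (fun E' => (reachCard S (insert s(a, y) E') : ℝ) < M) ≤
          subsetProb p (E.erase s(a, y)) (fun E' => (reachCard (insert y S) E' : ℝ) < M) :=
        subsetProb_mono hp0 hp1 _ fun E' _ h =>
          lt_of_le_of_lt (by exact_mod_cast reachCard_insert_le haS hyS) h
      rw [subsetProb_eq_erase p he]
      calc _ ≤ (1 - p) * (q ^ A.card * (1 - p + p * q) ^ (T.erase y).card) +
            p * (q ^ (A.card + 1) * (1 - p + p * q) ^ (T.erase y).card) :=
            add_le_add (mul_le_mul_of_nonneg_left habsent (sub_nonneg.2 hp1))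
              (mul_le_mul_of_nonneg_left (hmono.trans hpresent) hp0)
        _ = q ^ A.card * (1 - p + p * q) ^ T.card := by rw [← hTcard]; ring

end Exploration

theorem one_sub_mul_pow_le_one_sub {p s δ : ℝ} {n : ℕ} (hs0 : 0 ≤ s) (hs1 : s < 1)
    (hps : p * s ≤ 1) (hn : 1 + δ ≤ n * p) (hδ : 1 ≤ (1 - s) * (1 + δ)) :
    (1 - p * s) ^ n ≤ 1 - s := by
  have hs : 0 < 1 - s := sub_pos.2 hs1
  have hinv : (1 - s)⁻¹ ≤ Real.exp ((1 + δ) * s) := by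
    have h1 : s / (1 - s) ≤ (1 + δ) * s := by
      rw [div_le_iff₀ hs]
      nlinarith
    calc (1 - s)⁻¹ = s / (1 - s) + 1 := by field_simp; ring
      _ ≤ Real.exp (s / (1 - s)) := Real.add_one_le_exp _
      _ ≤ _ := Real.exp_le_exp.2 h1
  calc (1 - p * s) ^ n ≤ Real.exp (-(p * s)) ^ n :=
        pow_le_pow_left₀ (by linarith) (Real.one_sub_le_exp_neg _) _
    _ = Real.exp (-(n * p * s)) := by rw [← Real.exp_nat_mul]; congr 1; ring
    _ ≤ Real.exp (-((1 + δ) * s)) :=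
        Real.exp_le_exp.2 (neg_le_neg (mul_le_mul_of_nonneg_right hn hs0))
    _ ≤ 1 - s := by
        rw [Real.exp_neg]
        exact inv_le_of_inv_le₀ hs hinv

theorem MinDegreeAtLeast.le_card_filter_add_card {V : Type} [Fintype V] {G : SimpleGraph V}
    {k : ℕ} (h : MinDegreeAtLeast G k) (x : V) (S : Finset V) :
    k ≤ (Finset.univ.filter fun z => G.Adj x z ∧ z ∉ S).card + S.card := by
  have hk := h x
  rw [Nat.card_eq_fintype_card, ← Set.toFinset_card] at hk
  refine hk.trans ((Finset.card_le_card fun z hz => ?_).trans (Finset.card_union_le _ _))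
  by_cases hzS : z ∈ S
  · exact Finset.mem_union_right _ hzS
  · exact Finset.mem_union_left _ (by simpa [hzS] using hz)

/-- **Theorem 11.** Let `ε ∈ (0,1/3)`, let `k` be a positive integer, let `G` be a finite graph
with minimum degree at least `k`, and let `v` be a vertex of `G`. If `p ∈ [0,1]` satisfies
`p ≥ (1+ε)/k`, then with probability strictly greater than `ε/6`, the connected component of
`v` in `G_p` has at least `εk/2` vertices. -/
theorem large_component_of_vertex {V : Type} [Fintype V] (G : SimpleGraph V)
    (ε : ℝ) (hε0 : 0 < ε) (hε1 : ε < 1 / 3) (k : ℕ) (hk : 0 < k)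
    (hdeg : MinDegreeAtLeast G k) (v : V)
    (p : ℝ) (hp0 : 0 ≤ p) (hp1 : p ≤ 1) (hp : (1 + ε) / (k : ℝ) ≤ p) :
    ε / 6 <
      randProb G p (fun F =>
        ε * (k : ℝ) / 2 ≤ (Nat.card {w : V | F.Reachable v w} : ℝ)) := by
  have hk' : (0 : ℝ) < k := Nat.cast_pos.2 hk
  have hkp : 1 + ε ≤ p * k := (div_le_iff₀ hk').1 hp
  have hext : ∀ (S : Finset V), ∀ x ∈ S, (S.card : ℝ) < ε * k / 2 →
      (1 - p + p * (1 - ε / 5)) ^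
        (Finset.univ.filter fun z => G.Adj x z ∧ z ∉ S).card ≤ 1 - ε / 5 := by
    intro S x _ hS
    have hdeg' : (k : ℝ) ≤ (Finset.univ.filter fun z => G.Adj x z ∧ z ∉ S).card + S.card := by
      exact_mod_cast hdeg.le_card_filter_add_card x S
    have hbound := mul_le_mul_of_nonneg_right
      (show (k : ℝ) * (1 - ε / 2) ≤ (Finset.univ.filter fun z => G.Adj x z ∧ z ∉ S).card by
        linarith) hp0
    rw [show 1 - p + p * (1 - ε / 5) = 1 - p * (ε / 5) by ring]
    refine one_sub_mul_pow_le_one_sub (δ := ε / 3) (by linarith) (by linarith)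
      (by nlinarith) ?_ (by nlinarith)
    nlinarith
  have hsmall := subsetProb_reachCard_lt_le G hp0 hp1 (by linarith) hext _ {v} {v} ∅
    G.edgeFinset v le_rfl subset_rfl (by simp)
    (fun b z _ _ hbz => SimpleGraph.mem_edgeFinset.2 hbz)
  rw [Finset.card_singleton, pow_one, Finset.card_empty, pow_zero, mul_one] at hsmall
  have htotal := subsetProb_add_not p G.edgeFinset
    fun E' => (reachCard {v} E' : ℝ) < ε * k / 2
  have hlarge : randProb G p
      (fun F => ε * (k : ℝ) / 2 ≤ (Nat.card {w : V | F.Reachable v w} : ℝ)) =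
      subsetProb p G.edgeFinset fun E' => ¬ (reachCard {v} E' : ℝ) < ε * k / 2 := by
    simp only [randProb, subsetProb, reachCard, Finset.mem_singleton, exists_eq_left, not_lt]
  rw [hlarge]
  linarith
end

section
/- For every positive real ε there exists a positive real c such that the following holds for every sufficiently large integer k: if G is a finite graph on n vertices with minimum degree at least k, and p ∈ [0,1] satisfies p ≥ (1+ε)/k, then the expected number of excess edges of the p-random subgraph G_p is at least c·n. -/
open scoped Classical

/-- The expectation of `f` over a random subset of `S` containing each element independently
with probability `p`. -/
def bernExpect {α : Type*} (S : Finset α) (p : ℝ) (f : Finset α → ℝ) : ℝ :=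
  ∑ E ∈ S.powerset, f E * (p ^ E.card * (1 - p) ^ (S.card - E.card))

section BernExpect

variable {α : Type*} {S : Finset α} {p : ℝ}

lemma bernExpect_mono {f g : Finset α → ℝ} (hp0 : 0 ≤ p) (hp1 : p ≤ 1)
    (h : ∀ E ⊆ S, f E ≤ g E) : bernExpect S p f ≤ bernExpect S p g := by
  refine Finset.sum_le_sum fun E hE =>
    mul_le_mul_of_nonneg_right (h E (Finset.mem_powerset.1 hE)) ?_
  have : 0 ≤ 1 - p := by linarith
  positivity

lemma bernExpect_const (c : ℝ) : bernExpect S p (fun _ => c) = c := by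
  unfold bernExpect
  rw [← Finset.mul_sum, Finset.sum_pow_mul_eq_add_pow]
  simp

lemma bernExpect_pow_card (θ : ℝ) :
    bernExpect S p (fun E => θ ^ E.card) = (1 - p * (1 - θ)) ^ S.card := by
  have h := Finset.sum_pow_mul_eq_add_pow (θ * p) (1 - p) S
  rw [show 1 - p * (1 - θ) = θ * p + (1 - p) by ring, ← h]
  exact Finset.sum_congr rfl fun E _ => by rw [mul_pow]; ring

lemma bernExpect_sub (f g : Finset α → ℝ) :
    bernExpect S p (fun E => f E - g E) = bernExpect S p f - bernExpect S p g := by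
  simp only [bernExpect, sub_mul, Finset.sum_sub_distrib]

lemma bernExpect_const_mul (c : ℝ) (f : Finset α → ℝ) :
    bernExpect S p (fun E => c * f E) = c * bernExpect S p f := by
  simp only [bernExpect, mul_assoc, Finset.mul_sum]

lemma bernExpect_sum {ι : Type*} (I : Finset ι) (f : ι → Finset α → ℝ) :
    bernExpect S p (fun E => ∑ i ∈ I, f i E) = ∑ i ∈ I, bernExpect S p (f i) := by
  simp only [bernExpect, Finset.sum_mul]
  exact Finset.sum_comm

lemma bernExpect_insert [DecidableEq α] {e : α} (he : e ∉ S) (f : Finset α → ℝ) :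
    bernExpect (insert e S) p f =
      (1 - p) * bernExpect S p f + p * bernExpect S p (fun E => f (insert e E)) := by
  unfold bernExpect
  rw [Finset.sum_powerset_insert he, Finset.mul_sum, Finset.mul_sum]
  congr 1 <;> refine Finset.sum_congr rfl fun E hE => ?_
  · have hE' := Finset.card_le_card (Finset.mem_powerset.1 hE)
    rw [Finset.card_insert_of_notMem he, Nat.succ_sub hE', pow_succ]
    ring
  · have : e ∉ E := fun h => he (Finset.mem_powerset.1 hE h)
    rw [Finset.card_insert_of_notMem he, Finset.card_insert_of_notMem this,
      Nat.add_sub_add_right, pow_succ]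
    ring

lemma bernExpect_union [DecidableEq α] {T : Finset α} (h : Disjoint S T) (f : Finset α → ℝ) :
    bernExpect (S ∪ T) p f = bernExpect S p (fun E => bernExpect T p (fun E' => f (E ∪ E'))) := by
  induction S using Finset.induction_on generalizing f with
  | empty => simp [bernExpect]
  | insert e S he ih =>
    rw [Finset.disjoint_insert_left] at h
    rw [Finset.insert_union, bernExpect_insert (by simp [he, h.1]), bernExpect_insert he,
      ih h.2, ih h.2]
    simp only [Finset.insert_union]

lemma bernExpect_two_round [DecidableEq α] (q r : ℝ) (f : Finset α → ℝ) :
    bernExpect S (q + (1 - q) * r) f =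
      bernExpect S q (fun E => bernExpect S r (fun E' => f (E ∪ E'))) := by
  induction S using Finset.induction_on generalizing f with
  | empty => simp [bernExpect]
  | insert e S he ih =>
    have hadd : ∀ (a b : ℝ) (g h : Finset α → ℝ), bernExpect S q (fun E => a * g E + b * h E) =
        a * bernExpect S q g + b * bernExpect S q h := by
      intro a b g h
      simp only [bernExpect, add_mul, mul_assoc, Finset.sum_add_distrib, Finset.mul_sum]
    rw [bernExpect_insert he, bernExpect_insert he]
    simp only [bernExpect_insert he, Finset.insert_union, Finset.union_insert,
      Finset.insert_idem]
    rw [hadd, hadd, ih, ih]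
    ring

lemma bernExpect_mem [DecidableEq α] {e : α} (he : e ∈ S) :
    bernExpect S p (fun E => if e ∈ E then 1 else 0) = p := by
  rw [← Finset.insert_erase he, bernExpect_insert (Finset.notMem_erase e S)]
  have : bernExpect (S.erase e) p (fun E => if e ∈ E then 1 else 0) =
      bernExpect (S.erase e) p (fun _ => 0) := by
    refine Finset.sum_congr rfl fun E hE => ?_
    have : e ∉ E := fun h => Finset.notMem_erase e S (Finset.mem_powerset.1 hE h)
    simp [this]
  rw [this]
  simp [bernExpect_const]

/-- Harris' inequality. -/
lemma bernExpect_mul_le [DecidableEq α] (hp0 : 0 ≤ p) (hp1 : p ≤ 1) {f g : Finset α → ℝ}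
    (hf : Monotone f) (hg : Monotone g) :
    bernExpect S p f * bernExpect S p g ≤ bernExpect S p (fun E => f E * g E) := by
  induction S using Finset.induction_on generalizing f g with
  | empty => simp [bernExpect]
  | insert e S he ih =>
    have hins : Monotone (fun E : Finset α => insert e E) :=
      fun _ _ h => Finset.insert_subset_insert e h
    rw [bernExpect_insert he, bernExpect_insert he, bernExpect_insert he]
    have h0 := ih hf hg
    have h1 := ih (hf.comp hins) (hg.comp hins)
    simp only [Function.comp_def] at h1
    have hf' : bernExpect S p f ≤ bernExpect S p (fun E => f (insert e E)) :=
      bernExpect_mono hp0 hp1 fun E _ => hf (Finset.subset_insert e E)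
    have hg' : bernExpect S p g ≤ bernExpect S p (fun E => g (insert e E)) :=
      bernExpect_mono hp0 hp1 fun E _ => hg (Finset.subset_insert e E)
    have hp1' : 0 ≤ 1 - p := by linarith
    have h2 := mul_le_mul_of_nonneg_left h0 hp1'
    have h3 := mul_le_mul_of_nonneg_left h1 hp0
    have h4 := mul_nonneg (mul_nonneg hp0 hp1') (mul_nonneg (sub_nonneg.2 hf') (sub_nonneg.2 hg'))
    nlinarith [h2, h3, h4]

end BernExpect

section Components

variable {V : Type} {H : SimpleGraph V}

lemma SimpleGraph.Reachable.of_sup_edge_s9 {u v x y : V}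
    (h : (H ⊔ SimpleGraph.edge u v).Reachable x y) :
    H.Reachable x y ∨ (H.Reachable x u ∧ H.Reachable v y) ∨
      (H.Reachable x v ∧ H.Reachable u y) := by
  obtain ⟨w⟩ := h
  induction w with
  | nil => exact Or.inl (SimpleGraph.Reachable.refl _)
  | @cons a b c hab _ ih =>
    rw [SimpleGraph.sup_adj, SimpleGraph.edge_adj] at hab
    rcases hab with hab | ⟨⟨rfl, rfl⟩ | ⟨rfl, rfl⟩, -⟩
    · rcases ih with h | ⟨h, h'⟩ | ⟨h, h'⟩
      · exact Or.inl (hab.reachable.trans h)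
      · exact Or.inr (Or.inl ⟨hab.reachable.trans h, h'⟩)
      · exact Or.inr (Or.inr ⟨hab.reachable.trans h, h'⟩)
    · rcases ih with h | ⟨h, h'⟩ | ⟨h, h'⟩
      · exact Or.inr (Or.inl ⟨SimpleGraph.Reachable.refl _, h⟩)
      · exact Or.inr (Or.inl ⟨SimpleGraph.Reachable.refl _, h'⟩)
      · exact Or.inl h'
    · rcases ih with h | ⟨h, h'⟩ | ⟨h, h'⟩
      · exact Or.inr (Or.inr ⟨SimpleGraph.Reachable.refl _, h⟩)
      · exact Or.inl h'
      · exact Or.inr (Or.inr ⟨SimpleGraph.Reachable.refl _, h'⟩)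

lemma edgeCount_fromEdgeSet {E : Finset (Sym2 V)} (hE : ∀ e ∈ E, ¬ e.IsDiag) :
    edgeCount (SimpleGraph.fromEdgeSet (E : Set (Sym2 V))) = E.card := by
  have : (E : Set (Sym2 V)) \ Sym2.diagSet = E :=
    sdiff_eq_left.2 (Set.disjoint_left.2 fun e he h => hE e he h)
  rw [edgeCount, SimpleGraph.edgeSet_fromEdgeSet, this]
  simp

variable [Fintype V]

lemma card_connectedComponent_le_sup_edge (u v : V) :
    Nat.card H.ConnectedComponent ≤ Nat.card (H ⊔ SimpleGraph.edge u v).ConnectedComponent + 1 := by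
  have hinj : Set.InjOn (fun C : H.ConnectedComponent =>
      C.map (SimpleGraph.Hom.ofLE (le_sup_left : H ≤ H ⊔ SimpleGraph.edge u v)))
      {H.connectedComponentMk v}ᶜ := by
    intro C hC D hD hCD
    induction C using SimpleGraph.ConnectedComponent.ind with | _ x
    induction D using SimpleGraph.ConnectedComponent.ind with | _ y
    simp only [SimpleGraph.ConnectedComponent.map_mk, SimpleGraph.Hom.ofLE_apply,
      SimpleGraph.ConnectedComponent.eq, Set.mem_compl_iff, Set.mem_singleton_iff] at *
    rcases hCD.of_sup_edge_s9 with h | ⟨-, h⟩ | ⟨h, -⟩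
    · exact h
    · exact absurd h.symm hD
    · exact absurd h hC
  have h1 := Set.ncard_le_ncard_of_injOn _ (fun _ _ => Set.mem_univ _) hinj Set.finite_univ
  rw [Set.ncard_compl, Set.ncard_singleton, Set.ncard_univ] at h1
  omega

lemma excess_le_insert {E : Finset (Sym2 V)} {e : Sym2 V} (hE : ∀ e ∈ E, ¬ e.IsDiag)
    (he : ¬ e.IsDiag) :
    excess (SimpleGraph.fromEdgeSet (E : Set (Sym2 V))) ≤
      excess (SimpleGraph.fromEdgeSet ((insert e E : Finset (Sym2 V)) : Set (Sym2 V))) := by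
  by_cases hmem : e ∈ E
  · rw [Finset.insert_eq_self.2 hmem]
  · unfold excess
    rw [edgeCount_fromEdgeSet hE, edgeCount_fromEdgeSet (by simpa [he] using hE),
      Finset.card_insert_of_notMem hmem]
    induction e using Sym2.ind with | _ u v
    have hG : SimpleGraph.fromEdgeSet ((insert s(u, v) E : Finset (Sym2 V)) : Set (Sym2 V)) =
        SimpleGraph.fromEdgeSet (E : Set (Sym2 V)) ⊔ SimpleGraph.edge u v := by
      rw [Finset.coe_insert, Set.insert_eq, SimpleGraph.fromEdgeSet_union, sup_comm,
        SimpleGraph.edge]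
    rw [hG]
    have := card_connectedComponent_le_sup_edge
      (H := SimpleGraph.fromEdgeSet (E : Set (Sym2 V))) u v
    push_cast
    omega

lemma excess_le_union {E T : Finset (Sym2 V)} (hE : ∀ e ∈ E, ¬ e.IsDiag)
    (hT : ∀ e ∈ T, ¬ e.IsDiag) :
    excess (SimpleGraph.fromEdgeSet (E : Set (Sym2 V))) ≤
      excess (SimpleGraph.fromEdgeSet ((T ∪ E : Finset (Sym2 V)) : Set (Sym2 V))) := by
  induction T using Finset.induction_on with
  | empty => simp
  | insert e T _ ih =>
    simp only [Finset.mem_insert, forall_eq_or_imp] at hT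
    rw [Finset.insert_union]
    refine (ih hT.2).trans (excess_le_insert ?_ hT.1)
    intro e he
    exact (Finset.mem_union.1 he).elim (hT.2 e) (hE e)

lemma excess_nonneg {E : Finset (Sym2 V)} (hE : ∀ e ∈ E, ¬ e.IsDiag) :
    0 ≤ excess (SimpleGraph.fromEdgeSet (E : Set (Sym2 V))) := by
  have h := excess_le_union (E := ∅) (T := E) (by simp) hE
  rw [Finset.union_empty] at h
  refine le_trans ?_ h
  have h1 : edgeCount (SimpleGraph.fromEdgeSet ((∅ : Finset (Sym2 V)) : Set (Sym2 V))) = 0 := by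
    rw [edgeCount_fromEdgeSet (by simp)]; rfl
  have h2 : Function.Injective
      (SimpleGraph.fromEdgeSet ((∅ : Finset (Sym2 V)) : Set (Sym2 V))).connectedComponentMk := by
    intro x y h
    simpa using h
  have h3 := Nat.card_le_card_of_injective _ h2
  rw [Nat.card_eq_fintype_card] at h3
  unfold excess
  rw [h1, Nat.cast_zero]
  omega

/-- The set of vertices joined to some vertex of `X` by a path with edges in `E`. -/
noncomputable def reachSet (E : Finset (Sym2 V)) (X : Finset V) : Finset V :=
  Finset.univ.filter fun w =>
    ∃ x ∈ X, (SimpleGraph.fromEdgeSet (E : Set (Sym2 V))).Reachable x w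

lemma mem_reachSet {E : Finset (Sym2 V)} {X : Finset V} {w : V} :
    w ∈ reachSet E X ↔
      ∃ x ∈ X, (SimpleGraph.fromEdgeSet (E : Set (Sym2 V))).Reachable x w := by
  simp [reachSet]

lemma subset_reachSet (E : Finset (Sym2 V)) (X : Finset V) : X ⊆ reachSet E X :=
  fun x hx => mem_reachSet.2 ⟨x, hx, SimpleGraph.Reachable.refl x⟩

lemma reachSet_mono {E E' : Finset (Sym2 V)} (h : E ⊆ E') (X : Finset V) :
    reachSet E X ⊆ reachSet E' X := by
  intro w hw
  obtain ⟨x, hx, hxw⟩ := mem_reachSet.1 hw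
  exact mem_reachSet.2 ⟨x, hx,
    hxw.mono (SimpleGraph.fromEdgeSet_mono (Finset.coe_subset.2 h))⟩

lemma reachSet_singleton_eq {E : Finset (Sym2 V)} {x y : V}
    (h : (SimpleGraph.fromEdgeSet (E : Set (Sym2 V))).Reachable x y) :
    reachSet E {x} = reachSet E {y} := by
  ext w
  simp only [mem_reachSet, Finset.mem_singleton, exists_eq_left]
  exact ⟨h.symm.trans, h.trans⟩

/-- Among the components of a graph, those with at least `L` vertices number at most `n / L`. -/
lemma mul_card_large_components_le (E : Finset (Sym2 V)) (L : ℕ) :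
    L * Set.ncard {C : (SimpleGraph.fromEdgeSet (E : Set (Sym2 V))).ConnectedComponent |
      L ≤ (reachSet E {C.out}).card} ≤ Fintype.card V := by
  rw [Set.ncard_eq_toFinset_card', mul_comm, ← smul_eq_mul, ← Finset.card_univ]
  refine (Finset.card_nsmul_le_sum _ (fun C => (reachSet E {C.out}).card) L ?_).trans ?_
  · intro C hC
    simpa using hC
  · rw [← Finset.card_biUnion]
    · exact Finset.card_le_card (Finset.subset_univ _)
    · intro C _ D _ hCD
      refine Finset.disjoint_left.2 fun w hw hw' => hCD ?_
      simp only [mem_reachSet, Finset.mem_singleton, exists_eq_left] at hw hw'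
      rw [← C.out_eq, ← D.out_eq]
      exact SimpleGraph.ConnectedComponent.eq.2 (hw.trans hw'.symm)

/-- Adding edges between vertices in components with at least `L` vertices
keeps all smaller components. -/
lemma card_connectedComponent_le_union_large {E W : Finset (Sym2 V)} {L : ℕ}
    (hW : ∀ e ∈ W, ∀ v ∈ e, L ≤ (reachSet E {v}).card) :
    Nat.card (SimpleGraph.fromEdgeSet (E : Set (Sym2 V))).ConnectedComponent ≤
      Nat.card (SimpleGraph.fromEdgeSet ((W ∪ E : Finset (Sym2 V)) :
        Set (Sym2 V))).ConnectedComponent +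
      Set.ncard {C : (SimpleGraph.fromEdgeSet (E : Set (Sym2 V))).ConnectedComponent |
        L ≤ (reachSet E {C.out}).card} := by
  have hle : SimpleGraph.fromEdgeSet (E : Set (Sym2 V)) ≤
      SimpleGraph.fromEdgeSet ((W ∪ E : Finset (Sym2 V)) : Set (Sym2 V)) :=
    SimpleGraph.fromEdgeSet_mono (Finset.coe_subset.2 Finset.subset_union_right)
  have key : ∀ x y : V, (reachSet E {x}).card < L →
      (SimpleGraph.fromEdgeSet ((W ∪ E : Finset (Sym2 V)) : Set (Sym2 V))).Reachable x y →
      (SimpleGraph.fromEdgeSet (E : Set (Sym2 V))).Reachable x y := by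
    rintro x y hx ⟨w⟩
    induction w with
    | nil => exact SimpleGraph.Reachable.refl _
    | @cons a b c hab _ ih =>
      rw [SimpleGraph.fromEdgeSet_adj] at hab
      have hab' : (SimpleGraph.fromEdgeSet (E : Set (Sym2 V))).Adj a b := by
        rw [SimpleGraph.fromEdgeSet_adj]
        refine ⟨?_, hab.2⟩
        rcases Finset.mem_union.1 (Finset.mem_coe.1 hab.1) with h | h
        · exact absurd (hW _ h a (Sym2.mem_mk_left a b)) (by omega)
        · exact h
      rw [reachSet_singleton_eq hab'.reachable] at hx
      exact hab'.reachable.trans (ih hx)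
  have hinj : Set.InjOn (fun C : (SimpleGraph.fromEdgeSet (E : Set (Sym2 V))).ConnectedComponent =>
      C.map (SimpleGraph.Hom.ofLE hle)) {C | L ≤ (reachSet E {C.out}).card}ᶜ := by
    intro C hC D hD hCD
    have hC' : (reachSet E {C.out}).card < L := by simpa using hC
    rw [← C.out_eq, ← D.out_eq] at hCD ⊢
    exact SimpleGraph.ConnectedComponent.eq.2
      (key _ _ hC' (SimpleGraph.ConnectedComponent.eq.1 hCD))
  have h1 := Set.ncard_le_ncard_of_injOn _ (fun _ _ => Set.mem_univ _) hinj Set.finite_univ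
  rw [Set.ncard_compl, Set.ncard_univ] at h1
  omega

lemma card_large_edges_sub_le_excess {E W : Finset (Sym2 V)} {L : ℕ}
    (hE : ∀ e ∈ E, ¬ e.IsDiag) (hWd : ∀ e ∈ W, ¬ e.IsDiag) (hdisj : Disjoint W E)
    (hL : 0 < L) (hW : ∀ e ∈ W, ∀ v ∈ e, L ≤ (reachSet E {v}).card) :
    (W.card : ℝ) - Fintype.card V / L ≤
      excess (SimpleGraph.fromEdgeSet ((W ∪ E : Finset (Sym2 V)) : Set (Sym2 V))) := by
  have h1 := card_connectedComponent_le_union_large hW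
  have h2 := mul_card_large_components_le E L
  set m := Set.ncard {C : (SimpleGraph.fromEdgeSet (E : Set (Sym2 V))).ConnectedComponent |
      L ≤ (reachSet E {C.out}).card}
  have h3 := excess_nonneg hE
  have hm : (m : ℝ) ≤ Fintype.card V / L := by
    rw [le_div_iff₀ (by exact_mod_cast hL), mul_comm]
    exact_mod_cast h2
  have h4 : (W.card : ℤ) - m ≤
      excess (SimpleGraph.fromEdgeSet ((W ∪ E : Finset (Sym2 V)) : Set (Sym2 V))) := by
    unfold excess at h3 ⊢
    rw [edgeCount_fromEdgeSet hE] at h3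
    rw [edgeCount_fromEdgeSet (fun e he => (Finset.mem_union.1 he).elim (hWd e) (hE e)),
      Finset.card_union_of_disjoint hdisj, Nat.cast_add]
    omega
  have h5 : (W.card : ℝ) - m ≤
      excess (SimpleGraph.fromEdgeSet ((W ∪ E : Finset (Sym2 V)) : Set (Sym2 V))) := by
    exact_mod_cast h4
  linarith

end Components

section Exploration

variable {V : Type} [Fintype V] {G : SimpleGraph V}

/-- Exploring the random subgraph from the active vertices `A` among the discovered vertices `X`
dominates a branching process with `Bin(k - L, q)` offspring, until `L` vertices are found. -/
lemma one_sub_pow_le_bernExpect_reachSet {k L : ℕ} {q θ : ℝ} (hG : MinDegreeAtLeast G k)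
    (hq0 : 0 ≤ q) (hq1 : q ≤ 1) (hθ0 : 0 ≤ θ) (hθ1 : θ ≤ 1)
    (hθ : (1 - q * (1 - θ)) ^ (k - L) ≤ θ) (j : ℕ) :
    ∀ (S : Finset (Sym2 V)) (X A : Finset V), A ⊆ X →
      (∀ b ∉ X \ A, ∀ w ∉ X, G.Adj b w → s(b, w) ∈ S) → L ≤ (X \ A).card + j →
      1 - θ ^ A.card ≤ bernExpect S q (fun E => if L ≤ (reachSet E X).card then 1 else 0) := by
  induction j with
  | zero =>
    intro S X A _ _ hL
    have hX : L ≤ X.card := hL.trans (Finset.card_le_card Finset.sdiff_subset)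
    have : ∀ E : Finset (Sym2 V), L ≤ (reachSet E X).card :=
      fun E => hX.trans (Finset.card_le_card (subset_reachSet E X))
    simp only [this, if_true, bernExpect_const]
    linarith [pow_nonneg hθ0 A.card]
  | succ j ih =>
    intro S X A hAX hS hL
    by_cases hX : L ≤ X.card
    · have : ∀ E : Finset (Sym2 V), L ≤ (reachSet E X).card :=
        fun E => hX.trans (Finset.card_le_card (subset_reachSet E X))
      simp only [this, if_true, bernExpect_const]
      linarith [pow_nonneg hθ0 A.card]
    rcases A.eq_empty_or_nonempty with rfl | ⟨a, ha⟩
    · have h := bernExpect_mono (S := S) hq0 hq1 (f := fun _ => 0)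
        (g := fun E => if L ≤ (reachSet E X).card then 1 else 0)
        (fun E _ => by split_ifs <;> norm_num)
      rw [bernExpect_const] at h
      simpa using h
    set W : Finset V := Finset.univ.filter (fun w => w ∉ X ∧ G.Adj a w) with hWdef
    have hWmem : ∀ w, w ∈ W ↔ w ∉ X ∧ G.Adj a w := by simp [hWdef]
    have hinj : Function.Injective (fun w : V => s(a, w)) := fun x y h => Sym2.congr_right.1 h
    set Sa : Finset (Sym2 V) := W.image (fun w => s(a, w)) with hSa
    have hSaS : Sa ⊆ S := by
      intro e he
      obtain ⟨w, hw, rfl⟩ := Finset.mem_image.1 he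
      exact hS a (fun h => (Finset.mem_sdiff.1 h).2 ha) w ((hWmem w).1 hw).1 ((hWmem w).1 hw).2
    have hWcard : k - L ≤ Sa.card := by
      rw [hSa, Finset.card_image_of_injective _ hinj]
      have h1 := hG a
      have h2 : Nat.card (G.neighborSet a) = (Finset.univ.filter (G.Adj a)).card := by
        rw [Nat.card_eq_fintype_card, Fintype.card_subtype]
        rfl
      have h3 : Finset.univ.filter (G.Adj a) \ X ⊆ W := by
        intro w hw
        rw [Finset.mem_sdiff, Finset.mem_filter] at hw
        exact (hWmem w).2 ⟨hw.2, hw.1.2⟩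
      have h4 := Finset.card_le_card h3
      have h5 := Finset.le_card_sdiff X (Finset.univ.filter (G.Adj a))
      omega
    have haX := hAX ha
    have step : ∀ E ⊆ Sa, 1 - θ ^ (A.card - 1) * θ ^ E.card ≤
        bernExpect (S \ Sa) q (fun E' => if L ≤ (reachSet (E ∪ E') X).card then 1 else 0) := by
      intro E hE
      set N : Finset V := W.filter (fun w => s(a, w) ∈ E) with hN
      have hNE : N.image (fun w => s(a, w)) = E := by
        ext e
        constructor
        · intro he
          obtain ⟨w, hw, rfl⟩ := Finset.mem_image.1 he
          exact (Finset.mem_filter.1 hw).2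
        · intro he
          obtain ⟨w, hw, rfl⟩ := Finset.mem_image.1 (hE he)
          exact Finset.mem_image.2 ⟨w, Finset.mem_filter.2 ⟨hw, he⟩, rfl⟩
      have hNcard : N.card = E.card := by
        rw [← hNE, Finset.card_image_of_injective _ hinj]
      have hNX : Disjoint X N :=
        Finset.disjoint_right.2 fun w hw => ((hWmem w).1 (Finset.mem_filter.1 hw).1).1
      have hA'card : (A.erase a ∪ N).card = A.card - 1 + E.card := by
        rw [Finset.card_union_of_disjoint, Finset.card_erase_of_mem ha, hNcard]
        exact hNX.mono_left ((Finset.erase_subset a A).trans hAX)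
      have hsubA : insert a (X \ A) ⊆ (X ∪ N) \ (A.erase a ∪ N) := by
        intro x hx
        rw [Finset.mem_sdiff, Finset.mem_union, Finset.mem_union, not_or]
        rcases Finset.mem_insert.1 hx with rfl | hx
        · exact ⟨Or.inl haX, Finset.notMem_erase _ A, Finset.disjoint_left.1 hNX haX⟩
        · rw [Finset.mem_sdiff] at hx
          exact ⟨Or.inl hx.1, fun h => hx.2 (Finset.mem_of_mem_erase h),
            Finset.disjoint_left.1 hNX hx.1⟩
      have hih := ih (S \ Sa) (X ∪ N) (A.erase a ∪ N)
        (Finset.union_subset_union ((Finset.erase_subset a A).trans hAX) subset_rfl) ?_ ?_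
      · rw [hA'card, pow_add] at hih
        refine hih.trans (bernExpect_mono hq0 hq1 fun E' _ => ?_)
        have hsub : reachSet E' (X ∪ N) ⊆ reachSet (E ∪ E') X := by
          intro w hw
          obtain ⟨x, hx, hxw⟩ := mem_reachSet.1 hw
          have hxw' := hxw.mono (SimpleGraph.fromEdgeSet_mono
            (Finset.coe_subset.2 (Finset.subset_union_right (s₁ := E) (s₂ := E'))))
          rcases Finset.mem_union.1 hx with hx | hx
          · exact mem_reachSet.2 ⟨x, hx, hxw'⟩
          · refine mem_reachSet.2 ⟨a, haX, SimpleGraph.Reachable.trans ?_ hxw'⟩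
            have hxf := Finset.mem_filter.1 hx
            refine SimpleGraph.Adj.reachable ((SimpleGraph.fromEdgeSet_adj _).2 ⟨?_, ?_⟩)
            · exact Finset.mem_coe.2 (Finset.mem_union_left _ hxf.2)
            · exact ((hWmem x).1 hxf.1).2.ne
        have hcard := Finset.card_le_card hsub
        split_ifs with h1 h2
        · exact le_rfl
        · exact absurd (h1.trans hcard) h2
        · exact zero_le_one
        · exact le_rfl
      · intro b hb w hw hbw
        rw [Finset.mem_union, not_or] at hw
        rw [Finset.mem_sdiff]
        have hnot : s(b, w) ∉ Sa := by
          intro h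
          obtain ⟨x, hx, hxe⟩ := Finset.mem_image.1 h
          have hmem : a ∈ s(b, w) := hxe ▸ Sym2.mem_mk_left a x
          rcases Sym2.mem_iff.1 hmem with rfl | rfl
          · exact hb (hsubA (Finset.mem_insert_self _ _))
          · exact hw.1 haX
        exact ⟨hS b (fun h => hb (hsubA (Finset.mem_insert_of_mem h))) w hw.1 hbw, hnot⟩
      · have h1 := Finset.card_le_card hsubA
        rw [Finset.card_insert_of_notMem (fun h => (Finset.mem_sdiff.1 h).2 ha)] at h1
        omega
    rw [← Finset.union_sdiff_of_subset hSaS, bernExpect_union Finset.disjoint_sdiff]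
    refine le_trans ?_ (bernExpect_mono hq0 hq1 step)
    rw [bernExpect_sub, bernExpect_const, bernExpect_const_mul, bernExpect_pow_card]
    have hA : θ ^ A.card = θ ^ (A.card - 1) * θ := by
      rw [← pow_succ, Nat.sub_add_cancel (Finset.card_pos.2 ⟨a, ha⟩)]
    rw [hA]
    have hb0 : 0 ≤ 1 - q * (1 - θ) := by nlinarith
    have hb1 : 1 - q * (1 - θ) ≤ 1 := by nlinarith
    have := (pow_le_pow_of_le_one hb0 hb1 hWcard).trans hθ
    have := mul_le_mul_of_nonneg_left this (pow_nonneg hθ0 (A.card - 1))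
    linarith

end Exploration

section Sprinkling

lemma ite_sub_ite_mul_ite_le {P Q R : Prop} [Decidable P] [Decidable Q] [Decidable R]
    [Decidable (R ∧ ¬Q ∧ P)] :
    (((if P then 1 else 0) - if Q then 1 else 0) * if R then 1 else 0) ≤
      if R ∧ ¬Q ∧ P then (1 : ℝ) else 0 := by
  by_cases hP : P <;> by_cases hQ : Q <;> by_cases hR : R <;> simp [hP, hQ, hR]

variable {V : Type} [Fintype V] {G : SimpleGraph V}

lemma le_bernExpect_card_reachSet {k L : ℕ} {q δ : ℝ} (hG : MinDegreeAtLeast G k)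
    (hq0 : 0 ≤ q) (hq1 : q ≤ 1) (hδ : 0 < δ) (hk : 1 + δ ≤ q * (k - L : ℕ)) (v : V) :
    δ / (1 + δ) ≤
      bernExpect G.edgeFinset q (fun E => if L ≤ (reachSet E {v}).card then 1 else 0) := by
  have hδ' : 0 < 1 + δ := by linarith
  have hθ1 : 1 / (1 + δ) ≤ 1 := by rw [div_le_one hδ']; linarith
  have hρ : 1 - 1 / (1 + δ) = δ / (1 + δ) := by field_simp; ring
  have hθ : (1 - q * (1 - 1 / (1 + δ))) ^ (k - L) ≤ 1 / (1 + δ) := by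
    have h0 : 0 ≤ 1 - q * (1 - 1 / (1 + δ)) := by
      have : 0 < 1 / (1 + δ) := by positivity
      nlinarith
    have h1 : 1 - q * (1 - 1 / (1 + δ)) ≤ Real.exp (-(q * (1 - 1 / (1 + δ)))) :=
      Real.one_sub_le_exp_neg _
    refine (pow_le_pow_left₀ h0 h1 _).trans ?_
    rw [← Real.exp_nat_mul]
    have h2 : ((k - L : ℕ) : ℝ) * -(q * (1 - 1 / (1 + δ))) ≤ -δ := by
      have h3 := mul_le_mul_of_nonneg_right hk (by positivity : 0 ≤ δ / (1 + δ))
      have h4 : (1 + δ) * (δ / (1 + δ)) = δ := by field_simp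
      rw [hρ]
      nlinarith
    refine (Real.exp_le_exp.2 h2).trans ?_
    rw [Real.exp_neg, ← one_div]
    exact one_div_le_one_div_of_le hδ' (by linarith [Real.add_one_le_exp δ])
  have h := one_sub_pow_le_bernExpect_reachSet hG hq0 hq1 (by positivity) hθ1 hθ L
    G.edgeFinset {v} {v} subset_rfl (fun b _ w _ hbw => by simpa using hbw) (by simp)
  rw [← hρ]
  simpa only [Finset.card_singleton, pow_one] using h

lemma bernExpect_excess_ge {L : ℕ} {q r ρ : ℝ} (hL : 0 < L) (hq0 : 0 ≤ q) (hq1 : q ≤ 1)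
    (hr0 : 0 ≤ r) (hr1 : r ≤ 1) (hρ0 : 0 ≤ ρ)
    (hρ : ∀ v : V, ρ ≤
      bernExpect G.edgeFinset q (fun E => if L ≤ (reachSet E {v}).card then 1 else 0)) :
    G.edgeFinset.card * (r * (ρ ^ 2 - q)) - Fintype.card V / L ≤
      bernExpect G.edgeFinset (q + (1 - q) * r)
        (fun E => (excess (SimpleGraph.fromEdgeSet (E : Set (Sym2 V))) : ℝ)) := by
  have hd : ∀ E ⊆ G.edgeFinset, ∀ e ∈ E, ¬ e.IsDiag := fun E hE e he =>
    G.not_isDiag_of_mem_edgeSet (SimpleGraph.mem_edgeFinset.1 (hE he))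
  let good : Finset (Sym2 V) → Sym2 V → ℝ :=
    fun E e => if ∀ v ∈ e, L ≤ (reachSet E {v}).card then 1 else 0
  have hgood : ∀ e, ρ ^ 2 ≤ bernExpect G.edgeFinset q (fun E => good E e) := by
    intro e
    induction e using Sym2.ind with | _ u v
    have hmono : ∀ v : V, Monotone (fun E : Finset (Sym2 V) =>
        if L ≤ (reachSet E {v}).card then (1 : ℝ) else 0) := by
      intro v E E' h
      have := Finset.card_le_card (reachSet_mono h {v})
      dsimp only
      split_ifs with h1 h2
      · exact le_rfl
      · exact absurd (h1.trans this) h2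
      · exact zero_le_one
      · exact le_rfl
    have h1 := bernExpect_mul_le (S := G.edgeFinset) hq0 hq1 (hmono u) (hmono v)
    have h2 := mul_le_mul (hρ u) (hρ v) hρ0 (hρ0.trans (hρ u))
    rw [sq]
    refine (h2.trans h1).trans (le_of_eq (congrArg _ (funext fun E => ?_)))
    simp only [good, Sym2.mem_iff, forall_eq_or_imp, forall_eq]
    split_ifs <;> simp_all
  have hpoint : ∀ E ⊆ G.edgeFinset, ∀ E' ⊆ G.edgeFinset,
      ∑ e ∈ G.edgeFinset, (good E e - if e ∈ E then 1 else 0) * (if e ∈ E' then 1 else 0)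
        - Fintype.card V / L ≤
      (excess (SimpleGraph.fromEdgeSet ((E ∪ E' : Finset (Sym2 V)) : Set (Sym2 V))) : ℝ) := by
    intro E hE E' hE'
    set W : Finset (Sym2 V) :=
      E'.filter (fun e => e ∉ E ∧ ∀ v ∈ e, L ≤ (reachSet E {v}).card) with hW
    have hWE' : W ⊆ E' := Finset.filter_subset _ _
    have h1 := card_large_edges_sub_le_excess (E := E) (W := W) (hd E hE)
      (fun e he => hd E' hE' e (hWE' he))
      (Finset.disjoint_left.2 fun e he => (Finset.mem_filter.1 he).2.1) hL
      (fun e he => (Finset.mem_filter.1 he).2.2)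
    have h2 := excess_le_union (E := W ∪ E) (T := E')
      (fun e he => (Finset.mem_union.1 he).elim (fun h => hd E' hE' e (hWE' h)) (hd E hE e))
      (hd E' hE')
    rw [← Finset.union_assoc, Finset.union_eq_left.2 hWE', Finset.union_comm E' E] at h2
    have h2' : (excess (SimpleGraph.fromEdgeSet ((W ∪ E : Finset (Sym2 V)) : Set (Sym2 V))) : ℝ) ≤
        excess (SimpleGraph.fromEdgeSet ((E ∪ E' : Finset (Sym2 V)) : Set (Sym2 V))) := by
      exact_mod_cast h2
    have h3 : ∑ e ∈ G.edgeFinset, (good E e - if e ∈ E then 1 else 0) *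
        (if e ∈ E' then 1 else 0) ≤ (W.card : ℝ) := by
      have hWS : (W.card : ℝ) = ∑ e ∈ G.edgeFinset, if e ∈ W then 1 else 0 := by
        rw [Finset.sum_boole, Finset.filter_mem_eq_inter,
          Finset.inter_eq_right.2 (hWE'.trans hE')]
      rw [hWS]
      refine Finset.sum_le_sum fun e _ => ?_
      simp only [good, hW, Finset.mem_filter]
      exact ite_sub_ite_mul_ite_le
    linarith
  rw [bernExpect_two_round]
  have hinner : ∀ E ⊆ G.edgeFinset,
      ∑ e ∈ G.edgeFinset, r * (good E e - if e ∈ E then 1 else 0) - Fintype.card V / L ≤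
      bernExpect G.edgeFinset r (fun E' =>
        (excess (SimpleGraph.fromEdgeSet ((E ∪ E' : Finset (Sym2 V)) : Set (Sym2 V))) : ℝ)) := by
    intro E hE
    refine le_trans (le_of_eq ?_) (bernExpect_mono hr0 hr1 (hpoint E hE))
    rw [bernExpect_sub, bernExpect_const, bernExpect_sum]
    congr 1
    refine Finset.sum_congr rfl fun e he => ?_
    rw [bernExpect_const_mul, bernExpect_mem he, mul_comm]
  refine le_trans ?_ (bernExpect_mono hq0 hq1 hinner)
  rw [bernExpect_sub, bernExpect_const, bernExpect_sum]
  refine sub_le_sub_right ?_ _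
  rw [← nsmul_eq_mul]
  refine Finset.card_nsmul_le_sum _ _ _ fun e he => ?_
  rw [bernExpect_const_mul, bernExpect_sub, bernExpect_mem he]
  exact mul_le_mul_of_nonneg_left (sub_le_sub_right (hgood e) q) hr0

lemma MinDegreeAtLeast.mul_card_le_two_mul_card_edgeFinset {k : ℕ} (hG : MinDegreeAtLeast G k) :
    k * Fintype.card V ≤ 2 * G.edgeFinset.card := by
  rw [← G.sum_degrees_eq_twice_card_edges, mul_comm, ← smul_eq_mul, ← Finset.card_univ]
  refine Finset.card_nsmul_le_sum _ _ _ fun v _ => ?_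
  have := hG v
  rwa [Nat.card_eq_fintype_card, SimpleGraph.card_neighborSet_eq_degree] at this

end Sprinkling

/-- **Theorem 12.** For every positive `ε` there is a positive `c` such that for every
sufficiently large `k`, every finite graph `G` on `n` vertices with minimum degree at least
`k`, and every `p ∈ [0,1]` with `p ≥ (1+ε)/k`, the expected number of excess edges of `G_p`
is at least `c·n`. -/
theorem expected_excess_ge :
    ∀ ε : ℝ, 0 < ε → ∃ c : ℝ, 0 < c ∧ ∃ k₀ : ℕ, ∀ k : ℕ, k₀ ≤ k →
      ∀ (V : Type) [Fintype V], ∀ G : SimpleGraph V,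
        MinDegreeAtLeast G k →
          ∀ p : ℝ, 0 ≤ p → p ≤ 1 → (1 + ε) / (k : ℝ) ≤ p →
            c * (Fintype.card V : ℝ) ≤ randExpect G p (fun F => (excess F : ℝ)) := by
  intro ε hε
  set ρ : ℝ := (ε / 4) / (1 + ε / 4) with hρdef
  have hρ : 0 < ρ := by positivity
  obtain ⟨L, hL⟩ := exists_nat_ge (16 / (ε * ρ ^ 2))
  have hL0 : (0 : ℝ) < L := lt_of_lt_of_le (by positivity) hL
  obtain ⟨k₁, hk₁⟩ := exists_nat_ge ((1 + ε / 2) * 2 / ρ ^ 2)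
  obtain ⟨k₂, hk₂⟩ := exists_nat_ge ((1 + ε / 2) * L * 4 / ε)
  refine ⟨ε * ρ ^ 2 / 16, by positivity, max k₁ k₂, ?_⟩
  intro k hk V _ G hG p hp0 hp1 hp
  have hkk₁ : (k₁ : ℝ) ≤ k := by exact_mod_cast (le_max_left _ _).trans hk
  have hkk₂ : (k₂ : ℝ) ≤ k := by exact_mod_cast (le_max_right _ _).trans hk
  have hk0 : (0 : ℝ) < k := lt_of_lt_of_le (by positivity) (hk₁.trans hkk₁)
  set q : ℝ := (1 + ε / 2) / k with hq
  have hq0 : 0 < q := by positivity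
  have hρ1 : ρ < 1 := by
    rw [hρdef, div_lt_one (by positivity)]
    linarith
  have hqρ : q ≤ ρ ^ 2 / 2 := by
    have h := hk₁.trans hkk₁
    rw [div_le_iff₀ (by positivity)] at h
    rw [hq, div_le_iff₀ hk0]
    linarith
  have hq1 : q < 1 := by nlinarith
  have hpq : ε / (2 * k) ≤ p - q := by
    have : (1 + ε) / k = ε / (2 * k) + q := by
      rw [hq]
      field_simp
      ring
    linarith
  have hεk : 0 < ε / (2 * k) := by positivity
  set r : ℝ := (p - q) / (1 - q) with hr
  have hrp : q + (1 - q) * r = p := by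
    rw [hr, mul_div_cancel₀ _ (by linarith)]
    ring
  have hr1 : r ≤ 1 := by
    rw [hr, div_le_one (by linarith)]
    linarith
  have hr_ge : ε / (2 * k) ≤ r := by
    refine hpq.trans ?_
    rw [hr, le_div_iff₀ (by linarith)]
    nlinarith
  have hkL : 1 + ε / 4 ≤ q * (k - L : ℕ) := by
    have h := hk₂.trans hkk₂
    rw [div_le_iff₀ hε] at h
    have h1 : (k : ℝ) - L ≤ (k - L : ℕ) := by
      rw [sub_le_iff_le_add]
      exact_mod_cast le_tsub_add
    refine le_trans ?_ (mul_le_mul_of_nonneg_left h1 hq0.le)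
    rw [hq, div_mul_eq_mul_div, le_div_iff₀ hk0]
    nlinarith
  have hmain := bernExpect_excess_ge (G := G) (by exact_mod_cast hL0) hq0.le hq1.le
    (hεk.le.trans hr_ge) hr1 hρ.le
    (le_bernExpect_card_reachSet (L := L) hG hq0.le hq1.le (by positivity) hkL)
  rw [hrp] at hmain
  refine le_trans ?_ hmain
  have he : (k : ℝ) * Fintype.card V ≤ 2 * G.edgeFinset.card := by
    exact_mod_cast hG.mul_card_le_two_mul_card_edgeFinset
  have hgain : ε / (2 * k) * (ρ ^ 2 / 2) ≤ r * (ρ ^ 2 - q) :=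
    mul_le_mul hr_ge (by linarith) (by positivity) (hεk.le.trans hr_ge)
  have hedges : ε * ρ ^ 2 / 8 * Fintype.card V ≤ G.edgeFinset.card * (r * (ρ ^ 2 - q)) := by
    refine le_trans ?_ (mul_le_mul_of_nonneg_left hgain (Nat.cast_nonneg _))
    have h := mul_le_mul_of_nonneg_right he (by positivity : 0 ≤ ε * ρ ^ 2 / (8 * k))
    calc ε * ρ ^ 2 / 8 * Fintype.card V = k * Fintype.card V * (ε * ρ ^ 2 / (8 * k)) := by
          field_simp
      _ ≤ _ := h
      _ = _ := by
          field_simp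
          ring
  have hloss : (Fintype.card V : ℝ) / L ≤ ε * ρ ^ 2 / 16 * Fintype.card V := by
    rw [div_le_iff₀ (by positivity)] at hL
    rw [div_le_iff₀ hL0]
    have := mul_le_mul_of_nonneg_left hL (Nat.cast_nonneg (α := ℝ) (Fintype.card V))
    nlinarith
  linarith
end

section
/- For every positive real ε there exists a positive real c such that the following holds for every sufficiently large integer k: if G is a finite graph on n vertices with minimum degree at least k, and p ∈ [0,1] satisfies p ≥ (1+ε)/k, then with probability at least 1 − 2·exp(−c²·n/12), the number of excess edges of the p-random subgraph G_p is at least c·n. -/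
open scoped Classical

/-! ### Random subsets -/

/-- The expectation of `f` over the random subset of `E` that contains each element of `E`
independently with probability `p`. -/
noncomputable def subsetExpect {α : Type} (E : Finset α) (p : ℝ) (f : Finset α → ℝ) : ℝ :=
  ∑ S ∈ E.powerset, f S * (p ^ S.card * (1 - p) ^ (E.card - S.card))

namespace subsetExpect

variable {α : Type} {E : Finset α} {p q : ℝ} {f g : Finset α → ℝ}

theorem empty : subsetExpect ∅ p f = f ∅ := by
  simp [subsetExpect]

theorem add : subsetExpect E p (fun S => f S + g S) = subsetExpect E p f + subsetExpect E p g := by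
  simp [subsetExpect, add_mul, Finset.sum_add_distrib]

theorem const_mul (c : ℝ) : subsetExpect E p (fun S => c * f S) = c * subsetExpect E p f := by
  simp [subsetExpect, mul_assoc, Finset.mul_sum]

theorem sum {ι : Type} (s : Finset ι) (F : ι → Finset α → ℝ) :
    subsetExpect E p (fun S => ∑ i ∈ s, F i S) = ∑ i ∈ s, subsetExpect E p (F i) := by
  unfold subsetExpect
  rw [Finset.sum_comm]
  simp [Finset.sum_mul]

theorem congr (h : ∀ S ⊆ E, f S = g S) : subsetExpect E p f = subsetExpect E p g :=
  Finset.sum_congr rfl fun S hS => by rw [h S (Finset.mem_powerset.1 hS)]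

theorem mono (hp₀ : 0 ≤ p) (hp₁ : p ≤ 1) (h : ∀ S ⊆ E, f S ≤ g S) :
    subsetExpect E p f ≤ subsetExpect E p g :=
  Finset.sum_le_sum fun S hS => mul_le_mul_of_nonneg_right (h S (Finset.mem_powerset.1 hS))
    (mul_nonneg (pow_nonneg hp₀ _) (pow_nonneg (sub_nonneg.2 hp₁) _))

variable [DecidableEq α]

theorem insert_eq {a : α} (ha : a ∉ E) :
    subsetExpect (insert a E) p f =
      p * subsetExpect E p (fun S => f (insert a S)) + (1 - p) * subsetExpect E p f := by
  unfold subsetExpect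
  rw [Finset.sum_powerset_insert ha, add_comm, Finset.mul_sum, Finset.mul_sum]
  congr 1
  · refine Finset.sum_congr rfl fun S hS => ?_
    have hS' := Finset.mem_powerset.1 hS
    rw [Finset.card_insert_of_notMem ha, Finset.card_insert_of_notMem fun h => ha (hS' h),
      Nat.add_sub_add_right]
    ring
  · refine Finset.sum_congr rfl fun S hS => ?_
    have := Finset.card_le_card (Finset.mem_powerset.1 hS)
    rw [Finset.card_insert_of_notMem ha, Nat.sub_add_comm this]
    ring

theorem const (c : ℝ) : subsetExpect E p (fun _ => c) = c := by
  induction E using Finset.induction_on with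
  | empty => exact empty
  | insert a E ha ih => rw [insert_eq ha, ih]; ring

theorem nonneg (hp₀ : 0 ≤ p) (hp₁ : p ≤ 1) (h : ∀ S ⊆ E, 0 ≤ f S) : 0 ≤ subsetExpect E p f :=
  (const 0).symm.le.trans (mono hp₀ hp₁ h)

theorem mono_set {E' : Finset α} (hp₀ : 0 ≤ p) (hp₁ : p ≤ 1) (hE : E ⊆ E')
    (hf : ∀ a S, f S ≤ f (insert a S)) : subsetExpect E p f ≤ subsetExpect E' p f := by
  suffices ∀ D : Finset α, subsetExpect E p f ≤ subsetExpect (D ∪ E) p f by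
    simpa [Finset.union_eq_left.2 hE] using this E'
  intro D
  induction D using Finset.induction_on with
  | empty => simp
  | insert a D _ ih =>
    rw [Finset.insert_union]
    by_cases ha : a ∈ D ∪ E
    · rwa [Finset.insert_eq_of_mem ha]
    · have : subsetExpect (D ∪ E) p f ≤ subsetExpect (D ∪ E) p (fun S => f (insert a S)) :=
        mono hp₀ hp₁ fun S _ => hf a S
      rw [insert_eq ha]
      nlinarith

theorem mono_prob (hp₀ : 0 ≤ p) (hpq : p ≤ q) (hq₁ : q ≤ 1)
    (hf : ∀ a S, f S ≤ f (insert a S)) : subsetExpect E p f ≤ subsetExpect E q f := by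
  induction E using Finset.induction_on generalizing f with
  | empty => simp [empty]
  | insert a E ha ih =>
    have key : subsetExpect E q f ≤ subsetExpect E q (fun S => f (insert a S)) :=
      mono (hp₀.trans hpq) hq₁ fun S _ => hf a S
    have h₀ := ih hf
    have h₁ := ih (f := fun S => f (insert a S)) fun b S => by
      rw [Finset.insert_comm]; exact hf b _
    rw [insert_eq ha, insert_eq ha]
    have := mul_le_mul_of_nonneg_left h₁ hp₀
    have := mul_le_mul_of_nonneg_left h₀ (sub_nonneg.2 (hpq.trans hq₁))
    nlinarith

/-- A lower bound for the growth of the expectation of `f` in terms of lower bounds for the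
discrete derivatives of `f`. -/
theorem growth (hp₀ : 0 ≤ p) (hpq : p ≤ q) (hq₁ : q ≤ 1) (h : α → Finset α → ℝ)
    (hh : ∀ e a S, h e S ≤ h e (insert a S))
    (hf : ∀ e ∈ E, ∀ S, e ∉ S → h e S ≤ f (insert e S) - f S) :
    (q - p) * ∑ e ∈ E, subsetExpect (E.erase e) p (h e) ≤
      subsetExpect E q f - subsetExpect E p f := by
  induction E using Finset.induction_on generalizing f h with
  | empty => simp [empty]
  | insert a E ha ih =>
    have hp₁ := hpq.trans hq₁
    have hq₀ := hp₀.trans hpq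
    have key : subsetExpect E p (h a) ≤
        subsetExpect E q (fun S => f (insert a S)) - subsetExpect E q f := by
      refine (mono_prob hp₀ hpq hq₁ (hh a)).trans (le_sub_iff_add_le.2 ?_)
      rw [← add]
      refine mono hq₀ hq₁ fun S hS => ?_
      have := hf a (Finset.mem_insert_self _ _) S fun h => ha (hS h)
      linarith
    have h₀ := ih h hh fun e he S heS => hf e (Finset.mem_insert_of_mem he) S heS
    have h₁ := ih (f := fun S => f (insert a S)) (fun e S => h e (insert a S))
      (fun e b S => by rw [Finset.insert_comm]; exact hh e b _) (fun e he S heS => by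
        rw [Finset.insert_comm]
        refine hf e (Finset.mem_insert_of_mem he) _ fun h => ?_
        rcases Finset.mem_insert.1 h with rfl | h
        · exact ha he
        · exact heS h)
    have hsum : ∑ e ∈ E, subsetExpect ((insert a E).erase e) p (h e) =
        p * ∑ e ∈ E, subsetExpect (E.erase e) p (fun S => h e (insert a S)) +
          (1 - p) * ∑ e ∈ E, subsetExpect (E.erase e) p (h e) := by
      rw [Finset.mul_sum, Finset.mul_sum, ← Finset.sum_add_distrib]
      refine Finset.sum_congr rfl fun e he => ?_
      rw [Finset.erase_insert_of_ne (by rintro rfl; exact ha he),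
        insert_eq fun h => ha (Finset.mem_of_mem_erase h)]
    rw [insert_eq ha, insert_eq ha, Finset.sum_insert ha, Finset.erase_insert ha, hsum]
    have e₁ := mul_le_mul_of_nonneg_left key (sub_nonneg.2 hpq)
    have e₂ := mul_le_mul_of_nonneg_left h₁ hp₀
    have e₃ := mul_le_mul_of_nonneg_left h₀ (sub_nonneg.2 hp₁)
    linarith

/-- Thinning a `p`-random subset with retention probability `q` gives a `p * q`-random subset. -/
theorem thinning : subsetExpect E p (fun S => subsetExpect S q f) = subsetExpect E (p * q) f := by
  induction E using Finset.induction_on generalizing f with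
  | empty => simp [empty]
  | insert a E ha ih =>
    have h : subsetExpect E p (fun S => subsetExpect (insert a S) q f) =
        subsetExpect E p (fun S => q * subsetExpect S q (fun S => f (insert a S)) +
          (1 - q) * subsetExpect S q f) :=
      congr fun S hS => insert_eq fun h => ha (hS h)
    rw [insert_eq ha, h, add, const_mul, const_mul, ih, ih, insert_eq ha]
    ring

theorem indicator_superset {T : Finset α} (hT : T ⊆ E) :
    subsetExpect E p (fun S => if T ⊆ S then 1 else 0) = p ^ T.card := by
  induction E using Finset.induction_on generalizing T with
  | empty => simp [Finset.subset_empty.1 hT, empty]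
  | insert a E ha ih =>
    rw [insert_eq ha]
    by_cases haT : a ∈ T
    · have h₀ : subsetExpect E p (fun S => if T ⊆ S then 1 else 0) = 0 :=
        (congr fun S hS => if_neg fun hTS : T ⊆ S => ha (hS (hTS haT))).trans (const 0)
      have h₁ : subsetExpect E p (fun S => if T ⊆ insert a S then 1 else 0) =
          p ^ (T.erase a).card := by
        rw [← ih (T := T.erase a) (Finset.subset_insert_iff.1 hT)]
        simp only [Finset.subset_insert_iff]
      rw [h₀, h₁, ← Finset.card_erase_add_one haT]
      ring
    · simp only [Finset.subset_insert_iff_of_notMem haT]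
      rw [ih ((Finset.subset_insert_iff_of_notMem haT).1 hT)]
      ring

/-- If every set in a family `P` contains a set of size at most `r` certifying the membership in
the family, then thinning with retention probability `q` costs at most a factor `q ^ r`. -/
theorem thinning_indicator_le (hp₀ : 0 ≤ p) (hp₁ : p ≤ 1) (hq₀ : 0 ≤ q) (hq₁ : q ≤ 1)
    {P : Finset α → Prop} {r : ℕ}
    (hP : ∀ S, P S → ∃ T ⊆ S, T.card ≤ r ∧ ∀ S', T ⊆ S' → S' ⊆ S → P S') :
    q ^ r * subsetExpect E p (fun S => if P S then 1 else 0) ≤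
      subsetExpect E (p * q) (fun S => if P S then 1 else 0) := by
  rw [← thinning, ← const_mul]
  refine mono hp₀ hp₁ fun S _ => ?_
  by_cases hS : P S
  · obtain ⟨T, hTS, hTr, hT⟩ := hP S hS
    rw [if_pos hS, mul_one]
    refine (pow_le_pow_of_le_one hq₀ hq₁ hTr).trans ?_
    rw [← indicator_superset hTS]
    refine mono hq₀ hq₁ fun S' hS' => ?_
    by_cases h : T ⊆ S'
    · simp [h, hT S' h hS']
    · rw [if_neg h]; positivity
  · rw [if_neg hS, mul_zero]
    exact nonneg hq₀ hq₁ fun S' _ => by positivity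

theorem eq_of_vanish {B : Finset α} (hB : B ⊆ E) (hf : ∀ a ∈ B, ∀ S, a ∈ S → f S = 0) :
    subsetExpect E p f = (1 - p) ^ B.card * subsetExpect (E \ B) p f := by
  induction B using Finset.induction_on with
  | empty => simp
  | insert a B ha ih =>
    have haE : a ∈ E \ B := Finset.mem_sdiff.2 ⟨hB (Finset.mem_insert_self _ _), ha⟩
    have hE : E \ B = insert a (E \ insert a B) := by
      rw [Finset.sdiff_insert, Finset.insert_erase haE]
    have h₀ : subsetExpect (E \ insert a B) p (fun S => f (insert a S)) = 0 := by
      rw [← const (E := E \ insert a B) (p := p) 0]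
      exact congr fun S _ => hf a (Finset.mem_insert_self _ _) _ (Finset.mem_insert_self _ _)
    rw [ih ((Finset.subset_insert _ _).trans hB) fun b hb => hf b (Finset.mem_insert_of_mem hb),
      hE, insert_eq (by simp), h₀, Finset.card_insert_of_notMem ha]
    ring

/-- A Laplace transform bound for functions with discrete derivatives in `[0, 1]`. -/
theorem exp_neg_le (hp₀ : 0 ≤ p) (hp₁ : p ≤ 1) {t : ℝ} (ht₀ : 0 ≤ t) (ht₁ : t ≤ 1)
    (hf₀ : ∀ a S, f S ≤ f (insert a S)) (hf₁ : ∀ a S, f (insert a S) ≤ f S + 1) :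
    subsetExpect E p (fun S => Real.exp (-(t * f S))) ≤
      Real.exp (-(t * subsetExpect E p f) + t ^ 2 * p * E.card) := by
  induction E using Finset.induction_on generalizing f with
  | empty => simp [empty]
  | insert a E ha ih =>
    have h₀ := ih hf₀ hf₁
    have h₁ := ih (f := fun S => f (insert a S))
      (fun b S => by rw [Finset.insert_comm]; exact hf₀ b _)
      (fun b S => by rw [Finset.insert_comm]; exact hf₁ b _)
    have hd₀ : subsetExpect E p f ≤ subsetExpect E p (fun S => f (insert a S)) :=
      mono hp₀ hp₁ fun S _ => hf₀ a S
    have hd₁ : subsetExpect E p (fun S => f (insert a S)) ≤ subsetExpect E p f + 1 := by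
      rw [← const (E := E) (p := p) 1, ← add]
      exact mono hp₀ hp₁ fun S _ => hf₁ a S
    rw [insert_eq ha, insert_eq ha, Finset.card_insert_of_notMem ha]
    set x := subsetExpect E p f
    set y := subsetExpect E p (fun S => f (insert a S))
    obtain ⟨d, hd⟩ : ∃ d, d = t * (y - x) := ⟨_, rfl⟩
    have hd₂ : 0 ≤ d := by rw [hd]; exact mul_nonneg ht₀ (by linarith)
    have hd₃ : d ≤ t := by rw [hd]; exact mul_le_of_le_one_right ht₀ (by linarith)
    have hexp : Real.exp (-d) ≤ 1 - d + d ^ 2 := by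
      rw [Real.exp_neg, inv_le_iff_one_le_mul₀ (Real.exp_pos d)]
      have := Real.add_one_le_exp d
      nlinarith [mul_le_mul_of_nonneg_left this (by nlinarith : 0 ≤ 1 - d + d ^ 2),
        pow_nonneg hd₂ 3]
    have hmix : p * Real.exp (-d) + (1 - p) ≤ Real.exp (-(p * d) + t ^ 2 * p) := by
      refine le_trans ?_ (Real.add_one_le_exp _)
      have : d ^ 2 ≤ t ^ 2 := pow_le_pow_left₀ hd₂ hd₃ 2
      nlinarith [mul_le_mul_of_nonneg_left hexp hp₀, mul_le_mul_of_nonneg_left this hp₀]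
    calc _ ≤ p * Real.exp (-(t * y) + t ^ 2 * p * E.card) +
          (1 - p) * Real.exp (-(t * x) + t ^ 2 * p * E.card) :=
        add_le_add (mul_le_mul_of_nonneg_left h₁ hp₀)
          (mul_le_mul_of_nonneg_left h₀ (sub_nonneg.2 hp₁))
      _ = Real.exp (-(t * x) + t ^ 2 * p * E.card) * (p * Real.exp (-d) + (1 - p)) := by
        have : -(t * y) + t ^ 2 * p * E.card = (-(t * x) + t ^ 2 * p * E.card) + -d := by
          rw [hd]; ring
        rw [this, Real.exp_add]
        ring
      _ ≤ Real.exp (-(t * x) + t ^ 2 * p * E.card) * Real.exp (-(p * d) + t ^ 2 * p) :=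
        mul_le_mul_of_nonneg_left hmix (Real.exp_pos _).le
      _ = _ := by
        rw [← Real.exp_add, hd]
        push_cast
        ring_nf

/-- A lower tail bound for functions with discrete derivatives in `[0, 1]`. -/
theorem one_sub_exp_le (hp₀ : 0 ≤ p) (hp₁ : p ≤ 1) {t : ℝ} (ht₀ : 0 ≤ t) (ht₁ : t ≤ 1) (m : ℝ)
    (hf₀ : ∀ a S, f S ≤ f (insert a S)) (hf₁ : ∀ a S, f (insert a S) ≤ f S + 1) :
    1 - Real.exp (t * m - t * subsetExpect E p f + t ^ 2 * p * E.card) ≤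
      subsetExpect E p (fun S => if m ≤ f S then 1 else 0) := by
  have h : subsetExpect E p (fun S => 1 + -Real.exp (t * m) * Real.exp (-(t * f S))) ≤
      subsetExpect E p (fun S => if m ≤ f S then 1 else 0) := by
    refine mono hp₀ hp₁ fun S _ => ?_
    rw [neg_mul, ← Real.exp_add]
    split_ifs with hm
    · linarith [Real.exp_pos (t * m + -(t * f S))]
    · have : 0 ≤ t * m + -(t * f S) := by nlinarith
      linarith [Real.one_le_exp this]
  rw [add, const, const_mul] at h
  have h₁ := mul_le_mul_of_nonneg_left (exp_neg_le (E := E) hp₀ hp₁ ht₀ ht₁ hf₀ hf₁)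
    (Real.exp_pos (t * m)).le
  rw [← Real.exp_add] at h₁
  have h₂ : t * m + (-(t * subsetExpect E p f) + t ^ 2 * p * E.card) =
      t * m - t * subsetExpect E p f + t ^ 2 * p * E.card := by ring
  rw [h₂] at h₁
  linarith

end subsetExpect

/-! ### Excess and connected components of graphs given by edge sets -/

section EdgeSets

open SimpleGraph

variable {V : Type}

theorem fromEdgeSet_le_insert (e : Sym2 V) (S : Finset (Sym2 V)) :
    fromEdgeSet (S : Set (Sym2 V)) ≤ fromEdgeSet ((insert e S : Finset (Sym2 V)) : Set (Sym2 V)) :=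
  fromEdgeSet_mono (by simp)

theorem reachable_or_of_reachable_insert {S : Finset (Sym2 V)} {u v x y : V}
    (h : (fromEdgeSet ((insert s(u, v) S : Finset (Sym2 V)) : Set (Sym2 V))).Reachable x y) :
    (fromEdgeSet (S : Set (Sym2 V))).Reachable x y ∨
      ((fromEdgeSet (S : Set (Sym2 V))).Reachable x u ∧
        (fromEdgeSet (S : Set (Sym2 V))).Reachable v y) ∨
      ((fromEdgeSet (S : Set (Sym2 V))).Reachable x v ∧
        (fromEdgeSet (S : Set (Sym2 V))).Reachable u y) := by
  obtain ⟨w⟩ := h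
  induction w with
  | nil => exact Or.inl (Reachable.refl _)
  | @cons a b c hab _ ih =>
    rw [fromEdgeSet_adj, Finset.coe_insert, Set.mem_insert_iff] at hab
    obtain ⟨hab | hab, hne⟩ := hab
    · rcases Sym2.eq_iff.1 hab with ⟨rfl, rfl⟩ | ⟨rfl, rfl⟩
      · rcases ih with h | ⟨-, h⟩ | ⟨-, h⟩
        · exact Or.inr (Or.inl ⟨Reachable.refl _, h⟩)
        · exact Or.inr (Or.inl ⟨Reachable.refl _, h⟩)
        · exact Or.inl h
      · rcases ih with h | ⟨-, h⟩ | ⟨-, h⟩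
        · exact Or.inr (Or.inr ⟨Reachable.refl _, h⟩)
        · exact Or.inl h
        · exact Or.inr (Or.inr ⟨Reachable.refl _, h⟩)
    · have hr : (fromEdgeSet (S : Set (Sym2 V))).Reachable a b :=
        Adj.reachable ((fromEdgeSet_adj _).2 ⟨hab, hne⟩)
      exact ih.imp hr.trans (Or.imp (And.imp_left hr.trans) (And.imp_left hr.trans))

theorem edgeCount_insert {e : Sym2 V} {S : Finset (Sym2 V)} (he : e ∉ S) (hd : ¬e.IsDiag) :
    edgeCount (fromEdgeSet ((insert e S : Finset (Sym2 V)) : Set (Sym2 V))) =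
      edgeCount (fromEdgeSet (S : Set (Sym2 V))) + 1 := by
  have key (T : Finset (Sym2 V)) : edgeCount (fromEdgeSet (T : Set (Sym2 V))) =
      (T.filter fun e => ¬e.IsDiag).card := by
    rw [edgeCount, edgeSet_fromEdgeSet, Nat.card_coe_set_eq, ← Set.ncard_coe_finset]
    congr 1
    ext e
    simp
  rw [key, key, Finset.filter_insert, if_pos hd, Finset.card_insert_of_notMem]
  simp [he]

theorem fromEdgeSet_insert_of_isDiag {e : Sym2 V} (S : Finset (Sym2 V)) (hd : e.IsDiag) :
    fromEdgeSet ((insert e S : Finset (Sym2 V)) : Set (Sym2 V)) =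
      fromEdgeSet (S : Set (Sym2 V)) := by
  ext a b
  simp only [fromEdgeSet_adj, Finset.coe_insert, Set.mem_insert_iff]
  refine ⟨fun ⟨h, hne⟩ => ⟨h.resolve_left ?_, hne⟩, fun ⟨h, hne⟩ => ⟨Or.inr h, hne⟩⟩
  rintro rfl
  exact hne (Sym2.mk_isDiag_iff.1 hd)

/-- The two ends of `e` lie in the same component of the graph with edge set `S`. -/
def EndsReachable (S : Finset (Sym2 V)) (e : Sym2 V) : Prop :=
  ∃ u v, e = s(u, v) ∧ (fromEdgeSet (S : Set (Sym2 V))).Reachable u v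

theorem EndsReachable.insert {S : Finset (Sym2 V)} {e : Sym2 V} (h : EndsReachable S e)
    (a : Sym2 V) : EndsReachable (insert a S) e := by
  obtain ⟨u, v, he, h⟩ := h
  exact ⟨u, v, he, h.mono (fromEdgeSet_le_insert a S)⟩

variable [Fintype V]

theorem card_connectedComponent_le_insert (u v : V) (S : Finset (Sym2 V)) :
    Nat.card (fromEdgeSet (S : Set (Sym2 V))).ConnectedComponent ≤
      Nat.card (fromEdgeSet ((insert s(u, v) S : Finset (Sym2 V)) : Set (Sym2 V))).ConnectedComponent
        + 1 := by
  rw [← Finite.card_option]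
  refine Nat.card_le_card_of_injective (fun c =>
    if c = (fromEdgeSet (S : Set (Sym2 V))).connectedComponentMk v then none
    else some (c.map (Hom.ofLE (fromEdgeSet_le_insert s(u, v) S)))) ?_
  intro c d
  refine ConnectedComponent.ind₂ (fun x y h => ?_) c d
  simp only [ConnectedComponent.eq] at h ⊢
  by_cases hx : (fromEdgeSet (S : Set (Sym2 V))).Reachable x v
  · by_cases hy : (fromEdgeSet (S : Set (Sym2 V))).Reachable y v
    · exact hx.trans hy.symm
    · simp [hx, hy] at h
  · by_cases hy : (fromEdgeSet (S : Set (Sym2 V))).Reachable y v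
    · simp [hx, hy] at h
    · simp only [hx, hy, if_false, Option.some.injEq, ConnectedComponent.map_mk,
        ConnectedComponent.eq] at h
      rcases reachable_or_of_reachable_insert h with h | ⟨-, h⟩ | ⟨h, -⟩
      · exact h
      · exact absurd h.symm hy
      · exact absurd h hx

theorem card_connectedComponent_insert_of_reachable {u v : V} {S : Finset (Sym2 V)}
    (h : (fromEdgeSet (S : Set (Sym2 V))).Reachable u v) :
    Nat.card (fromEdgeSet (S : Set (Sym2 V))).ConnectedComponent ≤
      Nat.card
        (fromEdgeSet ((insert s(u, v) S : Finset (Sym2 V)) : Set (Sym2 V))).ConnectedComponent := by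
  refine Nat.card_le_card_of_injective
    (fun c => c.map (Hom.ofLE (fromEdgeSet_le_insert s(u, v) S))) ?_
  intro c d
  refine ConnectedComponent.ind₂ (fun x y hxy => ?_) c d
  simp only [ConnectedComponent.map_mk, ConnectedComponent.eq] at hxy ⊢
  rcases reachable_or_of_reachable_insert hxy with h' | ⟨h₁, h₂⟩ | ⟨h₁, h₂⟩
  · exact h'
  · exact h₁.trans (h.trans h₂)
  · exact h₁.trans (h.symm.trans h₂)

theorem card_connectedComponent_insert_le (e : Sym2 V) (S : Finset (Sym2 V)) :
    Nat.card (fromEdgeSet ((insert e S : Finset (Sym2 V)) : Set (Sym2 V))).ConnectedComponent ≤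
      Nat.card (fromEdgeSet (S : Set (Sym2 V))).ConnectedComponent :=
  ConnectedComponent.card_le_card_of_le (fromEdgeSet_le_insert e S)

theorem excess_le_excess_insert (e : Sym2 V) (S : Finset (Sym2 V)) :
    excess (fromEdgeSet (S : Set (Sym2 V))) ≤
      excess (fromEdgeSet ((insert e S : Finset (Sym2 V)) : Set (Sym2 V))) := by
  by_cases hd : e.IsDiag
  · rw [fromEdgeSet_insert_of_isDiag S hd]
  by_cases he : e ∈ S
  · rw [Finset.insert_eq_of_mem he]
  have h₁ := edgeCount_insert he hd
  induction e using Sym2.ind with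
  | _ u v =>
    have h₂ := card_connectedComponent_le_insert u v S
    unfold excess
    omega

theorem excess_insert_le (e : Sym2 V) (S : Finset (Sym2 V)) :
    excess (fromEdgeSet ((insert e S : Finset (Sym2 V)) : Set (Sym2 V))) ≤
      excess (fromEdgeSet (S : Set (Sym2 V))) + 1 := by
  by_cases hd : e.IsDiag
  · rw [fromEdgeSet_insert_of_isDiag S hd]
    omega
  by_cases he : e ∈ S
  · rw [Finset.insert_eq_of_mem he]
    omega
  have h₁ := edgeCount_insert he hd
  have h₂ := card_connectedComponent_insert_le e S
  unfold excess
  omega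

theorem excess_insert_of_endsReachable {e : Sym2 V} {S : Finset (Sym2 V)} (he : e ∉ S)
    (hd : ¬e.IsDiag) (h : EndsReachable S e) :
    excess (fromEdgeSet (S : Set (Sym2 V))) + 1 ≤
      excess (fromEdgeSet ((insert e S : Finset (Sym2 V)) : Set (Sym2 V))) := by
  obtain ⟨u, v, rfl, h⟩ := h
  have h₁ := edgeCount_insert he hd
  have h₂ := card_connectedComponent_insert_of_reachable h
  unfold excess
  omega

theorem excess_fromEdgeSet_nonneg (S : Finset (Sym2 V)) :
    0 ≤ excess (fromEdgeSet (S : Set (Sym2 V))) := by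
  induction S using Finset.induction_on with
  | empty =>
    have h : Nat.card (⊥ : SimpleGraph V).ConnectedComponent = Fintype.card V := by
      rw [← Nat.card_eq_fintype_card]
      refine (Nat.card_eq_of_bijective (⊥ : SimpleGraph V).connectedComponentMk ⟨?_, ?_⟩).symm
      · intro x y hxy
        simpa using ConnectedComponent.eq.1 hxy
      · exact ConnectedComponent.ind fun v => ⟨v, rfl⟩
    simp [excess, edgeCount, h, -Nat.card_eq_fintype_card]
  | insert e S _ ih => exact ih.trans (excess_le_excess_insert e S)

/-- The vertex set of the component of `v` in the graph with edge set `S`. -/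
noncomputable def componentOf (S : Finset (Sym2 V)) (v : V) : Finset V :=
  Finset.univ.filter fun u => (fromEdgeSet (S : Set (Sym2 V))).Reachable v u

theorem mem_componentOf {S : Finset (Sym2 V)} {u v : V} :
    u ∈ componentOf S v ↔ (fromEdgeSet (S : Set (Sym2 V))).Reachable v u := by
  simp [componentOf]

theorem self_mem_componentOf (S : Finset (Sym2 V)) (v : V) : v ∈ componentOf S v :=
  mem_componentOf.2 (Reachable.refl v)

theorem componentOf_mono {S T : Finset (Sym2 V)} (h : S ⊆ T) (v : V) :
    componentOf S v ⊆ componentOf T v := fun _ hu =>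
  mem_componentOf.2 ((mem_componentOf.1 hu).mono (fromEdgeSet_mono (by exact_mod_cast h)))

theorem mem_componentOf_of_mem {S : Finset (Sym2 V)} {v a b : V} (ha : a ∈ componentOf S v)
    (hab : s(a, b) ∈ S) : b ∈ componentOf S v := by
  by_cases h : a = b
  · exact h ▸ ha
  · exact mem_componentOf.2 ((mem_componentOf.1 ha).trans
      (Adj.reachable ((fromEdgeSet_adj _).2 ⟨hab, h⟩)))

theorem componentOf_eq_of_mem {S : Finset (Sym2 V)} {u v : V} (h : u ∈ componentOf S v) :
    componentOf S u = componentOf S v := by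
  ext x
  rw [mem_componentOf] at h
  rw [mem_componentOf, mem_componentOf]
  exact ⟨h.trans, h.symm.trans⟩

/-- Every component is spanned by fewer edges than it has vertices. -/
theorem exists_subset_componentOf_eq (S : Finset (Sym2 V)) (v : V) :
    ∃ T ⊆ S, T.card + 1 ≤ (componentOf S v).card ∧ componentOf T v = componentOf S v := by
  obtain ⟨T, hT, hmax⟩ := Finset.exists_max_image
    (S.powerset.filter fun T => T.card + 1 ≤ (componentOf T v).card)
    (fun T => (componentOf T v).card)
    ⟨∅, by simpa using ⟨v, self_mem_componentOf ∅ v⟩⟩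
  rw [Finset.mem_filter, Finset.mem_powerset] at hT
  suffices h : componentOf T v = componentOf S v from ⟨T, hT.1, h ▸ hT.2, h⟩
  refine (componentOf_mono hT.1 v).antisymm fun x hx => ?_
  by_contra hxT
  obtain ⟨w⟩ := mem_componentOf.1 hx
  obtain ⟨d, -, hd₁, hd₂⟩ := w.exists_boundary_dart (componentOf T v : Set V)
    (self_mem_componentOf T v) hxT
  have hd := ((fromEdgeSet_adj _).1 d.adj).1
  have hle : insert d.snd (componentOf T v) ⊆ componentOf (insert s(d.fst, d.snd) T) v := by
    refine Finset.insert_subset ?_ (componentOf_mono (Finset.subset_insert _ _) v)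
    exact mem_componentOf_of_mem (componentOf_mono (Finset.subset_insert _ _) v hd₁)
      (Finset.mem_insert_self _ _)
  have hcard := Finset.card_le_card hle
  rw [Finset.card_insert_of_notMem (by simpa using hd₂)] at hcard
  have := hmax (insert s(d.fst, d.snd) T) (by
    rw [Finset.mem_filter, Finset.mem_powerset]
    have := Finset.card_insert_le s(d.fst, d.snd) T
    exact ⟨Finset.insert_subset (by simpa using hd) hT.1, by omega⟩)
  omega

/-- The edges in `E` with exactly one end in `A`. -/
noncomputable def edgeBoundary (E : Finset (Sym2 V)) (A : Finset V) : Finset (Sym2 V) :=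
  E.filter fun e => ∃ a ∈ A, ∃ b ∉ A, e = s(a, b)

theorem componentOf_ne_of_mem_edgeBoundary {E S : Finset (Sym2 V)} {A : Finset V} {e : Sym2 V}
    {v : V} (he : e ∈ edgeBoundary E A) (heS : e ∈ S) : componentOf S v ≠ A := by
  obtain ⟨-, a, ha, b, hb, rfl⟩ := Finset.mem_filter.1 he
  rintro rfl
  exact hb (mem_componentOf_of_mem ha heS)

/-- If `A` has large edge boundary, then `A` is much less likely to be a component of the `p`-random
subset of `E` than of its thinning. -/
theorem subsetExpect_componentOf_eq_le {E : Finset (Sym2 V)} {p δ : ℝ} (hp₀ : 0 ≤ p) (hp₁ : p ≤ 1)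
    (hδ : 0 < δ) (v : V) {A : Finset V}
    (hA : (1 + δ) * A.card ≤ p * (edgeBoundary E A).card) :
    subsetExpect E p (fun S => if componentOf S v = A then 1 else 0) ≤
      (1 + δ)⁻¹ * subsetExpect E (p * (1 + δ)⁻¹) (fun S => if componentOf S v = A then 1 else 0) := by
  set q := (1 + δ)⁻¹ with hq
  have hq₀ : 0 < q := by positivity
  have hq₁ : q ≤ 1 := inv_le_one_of_one_le₀ (by linarith)
  have hqδ : q * (1 + δ) = 1 := inv_mul_cancel₀ (by positivity)
  have hpq₀ : 0 ≤ p * q := by positivity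
  have hpq₁ : p * q ≤ 1 := mul_le_one₀ hp₁ hq₀.le hq₁
  rcases Nat.eq_zero_or_pos A.card with h | h
  · have hne (S : Finset (Sym2 V)) : componentOf S v ≠ A := by
      rintro rfl
      exact (Finset.card_pos.2 ⟨v, self_mem_componentOf S v⟩).ne' h
    simp [hne, subsetExpect.const]
  obtain ⟨r, hr⟩ := Nat.exists_eq_add_of_le' h
  have hvanish : ∀ e ∈ edgeBoundary E A, ∀ S : Finset (Sym2 V), e ∈ S →
      (if componentOf S v = A then (1 : ℝ) else 0) = 0 :=
    fun e he S heS => if_neg (componentOf_ne_of_mem_edgeBoundary he heS)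
  have hsub : edgeBoundary E A ⊆ E := Finset.filter_subset _ _
  rw [subsetExpect.eq_of_vanish hsub hvanish, subsetExpect.eq_of_vanish hsub hvanish]
  have hthin : q ^ r * subsetExpect (E \ edgeBoundary E A) p
      (fun S => if componentOf S v = A then 1 else 0) ≤
        subsetExpect (E \ edgeBoundary E A) (p * q)
          (fun S => if componentOf S v = A then 1 else 0) := by
    convert subsetExpect.thinning_indicator_le (E := E \ edgeBoundary E A) hp₀ hp₁ hq₀.le hq₁
      (P := fun S => componentOf S v = A) (r := r) (fun S hS => by
      obtain ⟨T, hTS, hT, hTv⟩ := exists_subset_componentOf_eq S v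
      refine ⟨T, hTS, by rw [hS] at hT; omega, fun S' hT' hS' => ?_⟩
      refine Finset.Subset.antisymm ?_ ?_
      · exact hS ▸ componentOf_mono hS' v
      · rw [← hS, ← hTv]
        exact componentOf_mono hT' v)
  set x := subsetExpect (E \ edgeBoundary E A) p (fun S => if componentOf S v = A then 1 else 0)
  set y := subsetExpect (E \ edgeBoundary E A) (p * q)
    (fun S => if componentOf S v = A then 1 else 0)
  set b := (edgeBoundary E A).card
  have hx : 0 ≤ x := subsetExpect.nonneg hp₀ hp₁ fun S _ => by positivity
  have hbase : 1 - p ≤ (1 - p * q) * Real.exp (-(p * (1 - q))) := by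
    have h₁ := Real.add_one_le_exp (-(p * (1 - q)))
    have h₂ : 0 ≤ p * q * (p * (1 - q)) := by
      have := sub_nonneg.2 hq₁
      positivity
    nlinarith [mul_le_mul_of_nonneg_left h₁ (sub_nonneg.2 hpq₁)]
  have hexp : Real.exp (-(p * (1 - q))) ^ b ≤ q ^ (r + 1) := by
    have h₁ : Real.exp (-δ) ≤ q := by
      rw [Real.exp_neg, hq]
      exact inv_anti₀ (by positivity) (by linarith [Real.add_one_le_exp δ])
    refine le_trans ?_ (pow_le_pow_left₀ (Real.exp_pos _).le h₁ _)
    rw [← Real.exp_nat_mul, ← Real.exp_nat_mul, Real.exp_le_exp]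
    rw [hr] at hA
    have := mul_le_mul_of_nonneg_left hA (sub_nonneg.2 hq₁)
    have h₃ : (1 - q) * ((1 + δ) * ((r + 1 : ℕ) : ℝ)) = δ * ((r + 1 : ℕ) : ℝ) := by
      linear_combination (-((r + 1 : ℕ) : ℝ)) * hqδ
    linarith
  have hpow : (1 - p) ^ b ≤ (1 - p * q) ^ b * q ^ (r + 1) := by
    refine (pow_le_pow_left₀ (sub_nonneg.2 hp₁) hbase b).trans ?_
    rw [mul_pow]
    exact mul_le_mul_of_nonneg_left hexp (pow_nonneg (sub_nonneg.2 hpq₁) _)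
  have hfinal : (1 - p) ^ b * x ≤ q * ((1 - p * q) ^ b * y) := calc
    (1 - p) ^ b * x ≤ (1 - p * q) ^ b * q ^ (r + 1) * x := mul_le_mul_of_nonneg_right hpow hx
    _ = q * ((1 - p * q) ^ b * (q ^ r * x)) := by ring
    _ ≤ q * ((1 - p * q) ^ b * y) := by
      have := pow_nonneg (sub_nonneg.2 hpq₁) b
      gcongr
  convert hfinal

/-- It is unlikely that the component of a given vertex has large edge boundary. -/
theorem subsetExpect_large_edgeBoundary_le {E : Finset (Sym2 V)} {p δ : ℝ} (hp₀ : 0 ≤ p)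
    (hp₁ : p ≤ 1) (hδ : 0 < δ) (v : V) :
    subsetExpect E p (fun S => if (1 + δ) * (componentOf S v).card ≤
      p * (edgeBoundary E (componentOf S v)).card then 1 else 0) ≤ (1 + δ)⁻¹ := by
  set Q : Finset (Finset V) := Finset.univ.filter fun A =>
    (1 + δ) * (A.card : ℝ) ≤ p * (edgeBoundary E A).card with hQ
  have hsplit (S : Finset (Sym2 V)) : (if (1 + δ) * ((componentOf S v).card : ℝ) ≤
      p * (edgeBoundary E (componentOf S v)).card then (1 : ℝ) else 0) =
        ∑ A ∈ Q, if componentOf S v = A then 1 else 0 := by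
    rw [Finset.sum_ite_eq]
    simp [hQ]
  have hq₁ : (1 + δ)⁻¹ ≤ 1 := inv_le_one_of_one_le₀ (by linarith)
  simp only [hsplit]
  rw [subsetExpect.sum]
  calc _ ≤ ∑ A ∈ Q, (1 + δ)⁻¹ * subsetExpect E (p * (1 + δ)⁻¹)
          (fun S => if componentOf S v = A then 1 else 0) :=
        Finset.sum_le_sum fun A hA =>
          subsetExpect_componentOf_eq_le hp₀ hp₁ hδ v (Finset.mem_filter.1 hA).2
    _ = (1 + δ)⁻¹ * subsetExpect E (p * (1 + δ)⁻¹)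
          (fun S => ∑ A ∈ Q, if componentOf S v = A then 1 else 0) := by
        rw [subsetExpect.sum, Finset.mul_sum]
    _ ≤ (1 + δ)⁻¹ * 1 := by
        refine mul_le_mul_of_nonneg_left ?_ (by positivity)
        refine (subsetExpect.mono (g := fun _ => 1) (by positivity)
          (mul_le_one₀ hp₁ (by positivity) hq₁) fun S _ => ?_).trans (subsetExpect.const 1).le
        rw [Finset.sum_ite_eq]
        split_ifs <;> norm_num
    _ = _ := mul_one _

/-- The neighbours of `v` in the graph with edge set `E`, possibly including `v` itself. -/
noncomputable def linked (E : Finset (Sym2 V)) (v : V) : Finset V :=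
  Finset.univ.filter fun u => s(v, u) ∈ E

theorem sum_card_linked_inter_componentOf_le (E S : Finset (Sym2 V)) :
    ∑ v, (linked E v ∩ componentOf S v).card ≤ 2 * (E.filter (EndsReachable S)).card := by
  rw [← Finset.card_sigma]
  refine (Finset.card_le_mul_card_image (f := fun x : (_ : V) × V => s(x.1, x.2)) _ 2 ?_).trans
    (Nat.mul_le_mul_left 2 (Finset.card_le_card ?_))
  · intro e _
    induction e using Sym2.ind with
    | _ a b =>
      refine (Finset.card_le_card (t := {⟨a, b⟩, ⟨b, a⟩}) fun x hx => ?_).trans Finset.card_le_two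
      rcases Sym2.eq_iff.1 (Finset.mem_filter.1 hx).2 with ⟨h₁, h₂⟩ | ⟨h₁, h₂⟩
      · exact Finset.mem_insert.2 (Or.inl (Sigma.ext h₁ (heq_of_eq h₂)))
      · exact Finset.mem_insert_of_mem (Finset.mem_singleton.2 (Sigma.ext h₁ (heq_of_eq h₂)))
  · intro e he
    obtain ⟨⟨a, b⟩, hx, rfl⟩ := Finset.mem_image.1 he
    have hb := Finset.mem_inter.1 (Finset.mem_sigma.1 hx).2
    exact Finset.mem_filter.2 ⟨(Finset.mem_filter.1 hb.1).2, a, b, rfl, mem_componentOf.1 hb.2⟩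

theorem sum_card_linked_sdiff_le (E : Finset (Sym2 V)) (A : Finset V) :
    ∑ v ∈ A, (linked E v \ A).card ≤ (edgeBoundary E A).card := by
  rw [← Finset.card_sigma]
  refine Finset.card_le_card_of_injOn (fun x : (_ : V) × V => s(x.1, x.2)) ?_ ?_
  · rintro ⟨a, b⟩ hx
    obtain ⟨ha, hb⟩ := Finset.mem_sigma.1 hx
    obtain ⟨hb, hbA⟩ := Finset.mem_sdiff.1 hb
    exact Finset.mem_filter.2 ⟨(Finset.mem_filter.1 hb).2, a, ha, b, hbA, rfl⟩
  · rintro ⟨a, b⟩ hx ⟨c, d⟩ hy h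
    obtain ⟨ha, hb⟩ := Finset.mem_sigma.1 (Finset.mem_coe.1 hx)
    obtain ⟨hc, hd⟩ := Finset.mem_sigma.1 (Finset.mem_coe.1 hy)
    rcases Sym2.eq_iff.1 h with ⟨h₁, h₂⟩ | ⟨h₁, h₂⟩
    · exact Sigma.ext h₁ (heq_of_eq h₂)
    · exact absurd (h₁ ▸ ha) (Finset.mem_sdiff.1 hd).2

/-- If many vertices lie in components with small edge boundary, then many edges of `E` lie inside
components. -/
theorem mul_card_small_edgeBoundary_le {E : Finset (Sym2 V)} {k : ℕ}
    (hE : ∀ v, k ≤ (linked E v).card) (θ : ℝ) (S : Finset (Sym2 V)) :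
    ∑ v, (if ((edgeBoundary E (componentOf S v)).card : ℝ) ≤ (k - θ) * (componentOf S v).card
      then θ else 0) ≤ 2 * ((E.filter (EndsReachable S)).card : ℝ) := by
  have hle : ((∑ v, (linked E v ∩ componentOf S v).card : ℕ) : ℝ) ≤
      2 * ((E.filter (EndsReachable S)).card : ℝ) := by
    exact_mod_cast sum_card_linked_inter_componentOf_le E S
  refine le_trans ?_ hle
  push_cast
  rw [← Finset.sum_fiberwise Finset.univ (componentOf S), ← Finset.sum_fiberwise Finset.univ
    (componentOf S) fun v => ((linked E v ∩ componentOf S v).card : ℝ)]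
  refine Finset.sum_le_sum fun A _ => ?_
  have h₁ : ∀ v ∈ Finset.univ.filter (fun v => componentOf S v = A),
      (if ((edgeBoundary E (componentOf S v)).card : ℝ) ≤ (k - θ) * (componentOf S v).card
        then θ else 0) = if ((edgeBoundary E A).card : ℝ) ≤ (k - θ) * A.card then θ else 0 := by
    intro v hv
    rw [(Finset.mem_filter.1 hv).2]
  rw [Finset.sum_congr rfl h₁]
  by_cases hA : ((edgeBoundary E A).card : ℝ) ≤ (k - θ) * A.card
  swap
  · rw [if_neg hA, Finset.sum_const_zero]
    exact Finset.sum_nonneg fun _ _ => Nat.cast_nonneg _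
  rw [if_pos hA, Finset.sum_const, nsmul_eq_mul]
  rcases (Finset.univ.filter fun v => componentOf S v = A).eq_empty_or_nonempty with h | ⟨w, hw⟩
  · simp [h]
  have hfib : (Finset.univ.filter fun v => componentOf S v = A) = A := by
    have hw := (Finset.mem_filter.1 hw).2
    ext v
    rw [Finset.mem_filter]
    constructor
    · rintro ⟨-, rfl⟩
      exact self_mem_componentOf S v
    · rintro hv
      exact ⟨Finset.mem_univ _, (componentOf_eq_of_mem (hw.symm ▸ hv)).trans hw⟩
  have h₂ : ∀ v ∈ Finset.univ.filter (fun v => componentOf S v = A),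
      ((linked E v ∩ componentOf S v).card : ℝ) = (linked E v ∩ A).card := by
    intro v hv
    rw [(Finset.mem_filter.1 hv).2]
  rw [Finset.sum_congr rfl h₂, hfib]
  have hdeg : k * A.card ≤ ∑ v ∈ A, (linked E v ∩ A).card + ∑ v ∈ A, (linked E v \ A).card := by
    rw [← Finset.sum_add_distrib, mul_comm, ← smul_eq_mul, ← Finset.sum_const]
    refine Finset.sum_le_sum fun v _ => ?_
    rw [add_comm, Finset.card_sdiff_add_card_inter]
    exact hE v
  have hbd := sum_card_linked_sdiff_le E A
  have : (k : ℝ) * A.card ≤ ∑ v ∈ A, ((linked E v ∩ A).card : ℝ) + (edgeBoundary E A).card := by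
    exact_mod_cast hdeg.trans (Nat.add_le_add_left hbd _)
  linarith

theorem le_subsetExpect_card_endsReachable {E : Finset (Sym2 V)} {k : ℕ}
    (hE : ∀ v, k ≤ (linked E v).card) {p δ θ : ℝ} (hp₀ : 0 < p) (hp₁ : p ≤ 1) (hδ : 0 < δ)
    (hθ : 0 ≤ θ) (h : p * (k - θ) = 1 + δ) :
    θ * (1 - (1 + δ)⁻¹) * Fintype.card V ≤
      2 * ∑ e ∈ E, subsetExpect E p (fun S => if EndsReachable S e then 1 else 0) := by
  have hlow : subsetExpect E p (fun S => ∑ v : V, (θ + -θ * if (1 + δ) * (componentOf S v).card ≤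
      p * (edgeBoundary E (componentOf S v)).card then 1 else 0)) ≤
        subsetExpect E p (fun S => 2 * ∑ e ∈ E, if EndsReachable S e then 1 else 0) := by
    refine subsetExpect.mono hp₀.le hp₁ fun S _ => ?_
    rw [Finset.sum_boole]
    refine le_trans (Finset.sum_le_sum fun v _ => ?_) (mul_card_small_edgeBoundary_le hE θ S)
    by_cases hbad : (1 + δ) * ((componentOf S v).card : ℝ) ≤
        p * (edgeBoundary E (componentOf S v)).card
    · rw [if_pos hbad]
      split_ifs <;> linarith
    · rw [if_neg hbad, if_pos]
      · linarith
      · rw [not_le, ← h, mul_assoc] at hbad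
        exact (lt_of_mul_lt_mul_left hbad hp₀.le).le
  rw [subsetExpect.sum, subsetExpect.const_mul, subsetExpect.sum] at hlow
  refine le_trans ?_ hlow
  calc _ = ∑ _v : V, (θ + -θ * (1 + δ)⁻¹) := by
        rw [Finset.sum_const, Finset.card_univ, nsmul_eq_mul]
        ring
    _ ≤ _ := Finset.sum_le_sum fun v _ => by
        rw [subsetExpect.add, subsetExpect.const, subsetExpect.const_mul]
        have := mul_le_mul_of_nonneg_left
          (subsetExpect_large_edgeBoundary_le (E := E) hp₀.le hp₁ hδ v) hθ
        linarith

theorem le_subsetExpect_excess {E : Finset (Sym2 V)} (hd : ∀ e ∈ E, ¬e.IsDiag) {p q : ℝ}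
    (hp₀ : 0 ≤ p) (hpq : p ≤ q) (hq₁ : q ≤ 1) :
    (q - p) * (∑ e ∈ E, subsetExpect E p (fun S => if EndsReachable S e then 1 else 0) -
        p * E.card) ≤
      subsetExpect E q (fun S => (excess (fromEdgeSet (S : Set (Sym2 V))) : ℝ)) := by
  have hp₁ := hpq.trans hq₁
  have hgrowth := subsetExpect.growth (E := E) hp₀ hpq hq₁
    (f := fun S => (excess (fromEdgeSet (S : Set (Sym2 V))) : ℝ))
    (fun e S => if EndsReachable S e then 1 else 0)
    (fun e a S => by
      by_cases h : EndsReachable S e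
      · simp [h, h.insert a]
      · rw [if_neg h]
        positivity)
    (fun e he S heS => by
      split_ifs with h
      · have : (excess (fromEdgeSet (S : Set (Sym2 V))) : ℝ) + 1 ≤
            excess (fromEdgeSet ((insert e S : Finset (Sym2 V)) : Set (Sym2 V))) := by
          exact_mod_cast excess_insert_of_endsReachable heS (hd e he) h
        linarith
      · exact sub_nonneg.2 (by exact_mod_cast excess_le_excess_insert e S))
  have hnonneg : 0 ≤ subsetExpect E p
      (fun S => (excess (fromEdgeSet (S : Set (Sym2 V))) : ℝ)) :=
    subsetExpect.nonneg hp₀ hp₁ fun S _ => by exact_mod_cast excess_fromEdgeSet_nonneg S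
  have hsum : ∑ e ∈ E, subsetExpect E p (fun S => if EndsReachable S e then 1 else 0) -
      p * E.card ≤
        ∑ e ∈ E, subsetExpect (E.erase e) p (fun S => if EndsReachable S e then 1 else 0) := by
    rw [mul_comm, ← nsmul_eq_mul, ← Finset.sum_const, ← Finset.sum_sub_distrib]
    refine Finset.sum_le_sum fun e he => ?_
    rw [sub_le_iff_le_add]
    nth_rw 1 [← Finset.insert_erase he]
    rw [subsetExpect.insert_eq (Finset.notMem_erase e E)]
    have h₁ : subsetExpect (E.erase e) p
        (fun S => if EndsReachable (insert e S) e then 1 else 0) ≤ 1 :=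
      (subsetExpect.mono (g := fun _ => 1) hp₀ hp₁ fun S _ => by
        split_ifs <;> norm_num).trans (subsetExpect.const 1).le
    have h₂ : 0 ≤ subsetExpect (E.erase e) p (fun S => if EndsReachable S e then 1 else 0) :=
      subsetExpect.nonneg hp₀ hp₁ fun S _ => by positivity
    nlinarith
  have := mul_le_mul_of_nonneg_left hsum (sub_nonneg.2 hpq)
  linarith

theorem exists_sparse_edge_subset {G : SimpleGraph V} {k : ℕ} (hG : MinDegreeAtLeast G k) :
    ∃ E ⊆ G.edgeFinset, E.card ≤ k * Fintype.card V ∧ ∀ v, k ≤ (linked E v).card := by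
  have hN (v : V) : ∃ N : Finset V, N.card = k ∧ ∀ u ∈ N, G.Adj v u := by
    have h := hG v
    rw [Nat.card_eq_fintype_card, card_neighborSet_eq_degree] at h
    obtain ⟨N, hN, hk⟩ := Finset.exists_subset_card_eq h
    exact ⟨N, hk, fun u hu => (mem_neighborFinset _ _ _).1 (hN hu)⟩
  choose N hk hadj using hN
  refine ⟨Finset.univ.biUnion fun v => (N v).image fun u => s(v, u), ?_, ?_, fun v => ?_⟩
  · intro e he
    obtain ⟨v, -, he⟩ := Finset.mem_biUnion.1 he
    obtain ⟨u, hu, rfl⟩ := Finset.mem_image.1 he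
    exact mem_edgeFinset.2 (hadj v u hu)
  · rw [mul_comm, ← Finset.card_univ]
    exact Finset.card_biUnion_le_card_mul _ _ _ fun v _ => Finset.card_image_le.trans (hk v).le
  · rw [← hk v]
    refine Finset.card_le_card fun u hu => Finset.mem_filter.2 ⟨Finset.mem_univ _, ?_⟩
    exact Finset.mem_biUnion.2 ⟨v, Finset.mem_univ _, Finset.mem_image_of_mem _ hu⟩

/-- The expected excess is linear in the number of vertices. -/
theorem linear_le_subsetExpect_excess {E : Finset (Sym2 V)} (hd : ∀ e ∈ E, ¬e.IsDiag) {k : ℕ}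
    (hE : ∀ v, k ≤ (linked E v).card) (hcard : E.card ≤ k * Fintype.card V) {ε : ℝ} (hε : 0 < ε)
    (hk : 0 < k) (hk₁ : (1 + ε) / k ≤ 1)
    (hk₂ : 4 * (1 + ε / 2) ≤ ε / (4 + 2 * ε) * (ε / (4 + ε)) * k) :
    ε * (ε / (4 + 2 * ε)) * (ε / (4 + ε)) / 8 * Fintype.card V ≤
      subsetExpect E ((1 + ε) / k) (fun S => (excess (fromEdgeSet (S : Set (Sym2 V))) : ℝ)) := by
  have hk₀ : (0 : ℝ) < k := by exact_mod_cast hk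
  have hpq : (1 + ε / 2) / k ≤ (1 + ε) / k := by gcongr; linarith
  have hp₀ : 0 < (1 + ε / 2) / k := by positivity
  refine le_trans ?_ (le_subsetExpect_excess hd hp₀.le hpq hk₁)
  have h := le_subsetExpect_card_endsReachable hE hp₀ (hpq.trans hk₁) (δ := ε / 4)
    (θ := k * (ε / (4 + 2 * ε))) (by positivity) (by positivity) (by field_simp; ring)
  have hη : 1 - (1 + ε / 4)⁻¹ = ε / (4 + ε) := by field_simp; ring
  rw [hη] at h
  have hcard' : (1 + ε / 2) / k * E.card ≤ (1 + ε / 2) * Fintype.card V := by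
    have : (E.card : ℝ) ≤ k * Fintype.card V := by exact_mod_cast hcard
    rw [div_mul_eq_mul_div, div_le_iff₀ hk₀]
    nlinarith
  have hdiff : (1 + ε) / k - (1 + ε / 2) / k = ε / (2 * k) := by field_simp; ring
  rw [hdiff]
  set a := ε / (4 + 2 * ε)
  set b := ε / (4 + ε)
  set n : ℝ := (Fintype.card V : ℝ)
  have hn : 0 ≤ n := Nat.cast_nonneg _
  calc ε * a * b / 8 * n = ε / (2 * k) * (a * b * k * n / 4) := by field_simp; ring
    _ ≤ _ := by
      refine mul_le_mul_of_nonneg_left ?_ (by positivity)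
      have := mul_le_mul_of_nonneg_right hk₂ hn
      linarith

theorem subsetExpect_le_randProb {G : SimpleGraph V} {E : Finset (Sym2 V)} (hE : E ⊆ G.edgeFinset)
    {p q : ℝ} (hp₀ : 0 ≤ p) (hpq : p ≤ q) (hq₁ : q ≤ 1) (x : ℝ) :
    subsetExpect E p
        (fun S => if x ≤ (excess (fromEdgeSet (S : Set (Sym2 V))) : ℝ) then 1 else 0) ≤
      randProb G q (fun F => x ≤ (excess F : ℝ)) := by
  have hmono : ∀ (e : Sym2 V) (S : Finset (Sym2 V)),
      (if x ≤ (excess (fromEdgeSet (S : Set (Sym2 V))) : ℝ) then (1 : ℝ) else 0) ≤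
        if x ≤ (excess (fromEdgeSet ((insert e S : Finset (Sym2 V)) : Set (Sym2 V))) : ℝ)
          then 1 else 0 := by
    intro e S
    by_cases h : x ≤ (excess (fromEdgeSet (S : Set (Sym2 V))) : ℝ)
    · rw [if_pos h, if_pos (h.trans (by exact_mod_cast excess_le_excess_insert e S))]
    · rw [if_neg h]
      positivity
  refine (subsetExpect.mono_prob hp₀ hpq hq₁ hmono).trans
    ((subsetExpect.mono_set (hp₀.trans hpq) hq₁ hE hmono).trans_eq ?_)
  unfold subsetExpect randProb
  simp only [ite_mul, one_mul, zero_mul]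

end EdgeSets

/-- **Corollary 13.** For every positive `ε` there is a positive `c` such that for every
sufficiently large `k`, every finite graph `G` on `n` vertices with minimum degree at least
`k`, and every `p ∈ [0,1]` with `p ≥ (1+ε)/k`, with probability at least
`1 - 2·exp(-c²·n/12)` the number of excess edges of `G_p` is at least `c·n`. -/
theorem excess_ge_whp :
    ∀ ε : ℝ, 0 < ε → ∃ c : ℝ, 0 < c ∧ ∃ k₀ : ℕ, ∀ k : ℕ, k₀ ≤ k →
      ∀ (V : Type) [Fintype V], ∀ G : SimpleGraph V,
        MinDegreeAtLeast G k →
          ∀ p : ℝ, 0 ≤ p → p ≤ 1 → (1 + ε) / (k : ℝ) ≤ p →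
            1 - 2 * Real.exp (-(c ^ 2 * (Fintype.card V : ℝ) / 12)) ≤
              randProb G p (fun F => c * (Fintype.card V : ℝ) ≤ (excess F : ℝ)) := by
  intro ε hε
  refine ⟨ε * (ε / (4 + 2 * ε)) * (ε / (4 + ε)) / (16 * (1 + ε)), by positivity,
    ⌈4 * (1 + ε / 2) / (ε / (4 + 2 * ε) * (ε / (4 + ε)))⌉₊ + 1, ?_⟩
  intro k hk V _ G hG p hp₀ hp₁ hp
  have hk₀ : 0 < k := by omega
  have hk₂ : 4 * (1 + ε / 2) ≤ ε / (4 + 2 * ε) * (ε / (4 + ε)) * k := by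
    rw [← div_le_iff₀' (by positivity)]
    exact (Nat.le_ceil _).trans (by exact_mod_cast (Nat.le_succ _).trans hk)
  obtain ⟨E, hEG, hcard, hE⟩ := exists_sparse_edge_subset hG
  have hd : ∀ e ∈ E, ¬e.IsDiag := fun e he =>
    G.not_isDiag_of_mem_edgeSet (SimpleGraph.mem_edgeFinset.1 (hEG he))
  have hmean := linear_le_subsetExpect_excess hd hE hcard hε hk₀ (hp.trans hp₁) hk₂
  set c := ε * (ε / (4 + 2 * ε)) * (ε / (4 + ε)) / (16 * (1 + ε)) with hc
  have hq₀ : 0 ≤ (1 + ε) / (k : ℝ) := by positivity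
  have hc₀ : 0 < c := by positivity
  have hc₁ : c / 2 ≤ 1 := by
    have h₁ : ε / (4 + 2 * ε) ≤ 1 := (div_le_one (by positivity)).2 (by linarith)
    have h₂ : ε / (4 + ε) ≤ 1 := (div_le_one (by positivity)).2 (by linarith)
    have h₃ : ε * (ε / (4 + 2 * ε)) * (ε / (4 + ε)) ≤ ε :=
      mul_le_of_le_one_right (by positivity) h₂ |>.trans (mul_le_of_le_one_right hε.le h₁)
    have : c ≤ 1 := (div_le_one (by positivity)).2 (by linarith)
    linarith
  have hmean' : ε * (ε / (4 + 2 * ε)) * (ε / (4 + ε)) / 8 = 2 * c * (1 + ε) := by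
    rw [hc]
    field_simp
    ring
  rw [hmean'] at hmean
  have htail := subsetExpect.one_sub_exp_le (E := E) hq₀ (hp.trans hp₁) (half_pos hc₀).le hc₁
    (c * (Fintype.card V : ℝ))
    (f := fun S => (excess (SimpleGraph.fromEdgeSet (S : Set (Sym2 V))) : ℝ))
    (fun e S => by exact_mod_cast excess_le_excess_insert e S)
    (fun e S => by exact_mod_cast excess_insert_le e S)
  refine le_trans ?_ (htail.trans (subsetExpect_le_randProb hEG hq₀ hp hp₁ _))
  set μ := subsetExpect E ((1 + ε) / k)
    (fun S => (excess (SimpleGraph.fromEdgeSet (S : Set (Sym2 V))) : ℝ))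
  set n : ℝ := (Fintype.card V : ℝ) with hn_def
  have hn : 0 ≤ n := Nat.cast_nonneg _
  have hpE : (1 + ε) / k * E.card ≤ (1 + ε) * n := by
    have : (E.card : ℝ) ≤ k * n := by rw [hn_def]; exact_mod_cast hcard
    have hk' : (0 : ℝ) < k := by exact_mod_cast hk₀
    rw [div_mul_eq_mul_div, div_le_iff₀ hk']
    nlinarith
  have hexp : c / 2 * (c * n) - c / 2 * μ + (c / 2) ^ 2 * ((1 + ε) / k) * E.card ≤
      -(c ^ 2 * n / 12) := by
    have h₁ := mul_le_mul_of_nonneg_left hmean (half_pos hc₀).le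
    have h₂ := mul_le_mul_of_nonneg_left hpE (sq_nonneg (c / 2))
    have h₃ : 0 ≤ c ^ 2 * n * ε := by positivity
    have h₄ : 0 ≤ c ^ 2 * n := by positivity
    linarith
  have := Real.exp_le_exp.2 hexp
  have := Real.exp_pos (-(c ^ 2 * n / 12))
  linarith
end
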